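/- arXiv:1101.1019 — 3 statements merged into one kernel-verified Lean document; each statement's English description precedes it below -/
import Mathlib

section
/- Symmetric Borwein–Preiss principle. Let X be a reflexive real Banach space endowed with a Kadec norm ‖·‖ (the weak and norm topologies agree on the unit sphere of X), placed in the abstract symmetrization framework. Let f : X → ℝ ∪ {+∞} be a proper, bounded below, lower semicontinuous functional such that f(u^H) ≤ f(u) for all u ∈ S and all H ∈ ℋ*. Let u ∈ S, ρ > 0, σ > 0 and p ≥ 1 be such that f(u) < inf_X f + σρ^p. Then there exist v ∈ X and η ∈ X such that: (a) ‖v − v*‖_V < (K(C_Θ+1)+1)ρ; (b) ‖v − u‖ < ρ + ‖T_ρ u − u‖; (c) ‖η − u‖ ≤ ρ + ‖T_ρ u − u‖; (d) f(v) < inf_X f + σρ^p; (e) f(w) ≥ f(v) + σ(‖v − η‖^p − ‖w − η‖^p) for all w ∈ X. -/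
open Filter Topology Metric Set


theorem bp_ekeland {E : Type*} [MetricSpace E] [CompleteSpace E] (G : E → ℝ) (hG : Continuous G)
    (m : ℝ) (hm : ∀ x, m ≤ G x) (c : E) (ε : ℝ) (hε : 0 < ε) :
    ∃ η, G η ≤ G c ∧ ∀ y, G η - ε * dist η y ≤ G y := by
  have step : ∀ (n : ℕ) (x : E), ∃ x', G x' + ε * dist x x' ≤ G x ∧
      ∀ y, G y + ε * dist x y ≤ G x → G x' ≤ G y + 1 / ((n : ℝ) + 1) := by
    intro n x
    by_contra hcon
    push Not at hcon
    have hpos : (0:ℝ) < 1 / ((n : ℝ) + 1) := by positivity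
    have key : ∀ k : ℕ, ∃ y, G y + ε * dist x y ≤ G x ∧ G y ≤ G x - k * (1 / ((n : ℝ) + 1)) := by
      intro k
      induction k with
      | zero => exact ⟨x, by simp, by simp⟩
      | succ k ih =>
        obtain ⟨y, hy1, hy2⟩ := ih
        obtain ⟨z, hz1, hz2⟩ := hcon y hy1
        refine ⟨z, hz1, ?_⟩
        push_cast
        linarith
    obtain ⟨k, hk⟩ := exists_nat_gt ((G x - m) / (1 / ((n : ℝ) + 1)))
    rw [div_lt_iff₀ hpos] at hk
    obtain ⟨y, _, hy⟩ := key k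
    linarith [hm y]
  choose nx hnx1 hnx2 using step
  let x : ℕ → E := fun n => Nat.rec c (fun k y => nx k y) n
  have hx : ∀ n, x (n+1) = nx n (x n) := fun n => rfl
  have h1 : ∀ n k, G (x (n+k)) + ε * dist (x n) (x (n+k)) ≤ G (x n) := by
    intro n k
    induction k with
    | zero => simp
    | succ k ih =>
      have := hnx1 (n+k) (x (n+k))
      rw [← hx] at this
      have tri := dist_triangle (x n) (x (n+k)) (x (n+k+1))
      have : ε * dist (x n) (x (n+k+1)) ≤ ε * (dist (x n) (x (n+k)) + dist (x (n+k)) (x (n+k+1))) := by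
        gcongr
      rw [← add_assoc]
      linarith
  have hanti : Antitone (fun n => G (x n)) := by
    apply antitone_nat_of_succ_le
    intro n
    have := h1 n 1
    have h0 : 0 ≤ ε * dist (x n) (x (n+1)) := by positivity
    linarith
  have hconv : Tendsto (fun n => G (x n)) atTop (𝓝 (⨅ n, G (x n))) :=
    tendsto_atTop_ciInf hanti ⟨m, by rintro _ ⟨n, rfl⟩; exact hm _⟩
  have hL : ∀ n, (⨅ n, G (x n)) ≤ G (x n) := fun n =>
    ciInf_le ⟨m, by rintro _ ⟨n, rfl⟩; exact hm _⟩ n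
  have hc : CauchySeq x := by
    refine cauchySeq_of_le_tendsto_0' (fun n => (G (x n) - ⨅ n, G (x n)) / ε) ?_ ?_
    · intro n k hnk
      obtain ⟨j, rfl⟩ := Nat.exists_eq_add_of_le hnk
      rw [le_div_iff₀ hε]
      linarith [h1 n j, hL (n+j)]
    · have := (hconv.sub_const (⨅ n, G (x n))).div_const ε
      simpa using this
  obtain ⟨η, hη⟩ := cauchySeq_tendsto_of_complete hc
  have hGη : Tendsto (fun n => G (x n)) atTop (𝓝 (G η)) := (hG.tendsto η).comp hη
  have hS : ∀ n, G η + ε * dist (x n) η ≤ G (x n) := by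
    intro n
    have ht : Tendsto (fun k => G (x k) + ε * dist (x n) (x k)) atTop (𝓝 (G η + ε * dist (x n) η)) :=
      hGη.add ((tendsto_const_nhds.dist hη).const_mul ε)
    refine le_of_tendsto ht ?_
    filter_upwards [eventually_ge_atTop n] with k hk
    obtain ⟨j, rfl⟩ := Nat.exists_eq_add_of_le hk
    exact h1 n j
  refine ⟨η, ?_, ?_⟩
  · have := hS 0
    have h0 : 0 ≤ ε * dist (x 0) η := by positivity
    have h2 : x 0 = c := rfl
    rw [h2] at this h0
    linarith
  · intro y
    by_contra hcon
    push Not at hcon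
    have hy : ∀ n, G (x (n+1)) ≤ G y + 1 / ((n : ℝ) + 1) := by
      intro n
      rw [hx]
      apply hnx2
      have tri := dist_triangle (x n) η y
      have : ε * dist (x n) y ≤ ε * (dist (x n) η + dist η y) := by gcongr
      linarith [hS n]
    have l1 : Tendsto (fun n => G (x (n+1))) atTop (𝓝 (G η)) := hGη.comp (tendsto_add_atTop_nat 1)
    have l2 : Tendsto (fun n : ℕ => G y + 1 / ((n : ℝ) + 1)) atTop (𝓝 (G y + 0)) :=
      tendsto_const_nhds.add tendsto_one_div_add_atTop_nhds_zero_nat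
    have := le_of_tendsto_of_tendsto' l1 l2 hy
    have h0 : 0 ≤ ε * dist η y := by positivity
    linarith

theorem bp_weakstar {E : Type*} [NormedAddCommGroup E] [NormedSpace ℝ E] {J : Type*}
    (U : Ultrafilter J) (ζ : J → (E →L[ℝ] ℝ)) (R : ℝ) (hR : ∀ j, ‖ζ j‖ ≤ R) :
    ∃ z : E →L[ℝ] ℝ, ‖z‖ ≤ R ∧ ∀ x, Tendsto (fun j => ζ j x) U (𝓝 (z x)) := by
  have hc := WeakDual.isCompact_closedBall (𝕜 := ℝ) (E := E) 0 R
  rw [isCompact_iff_ultrafilter_le_nhds] at hc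
  obtain ⟨z, hz, hle⟩ := hc (U.map (fun j => StrongDual.toWeakDual (ζ j))) (by
    simp only [le_principal_iff, Ultrafilter.mem_coe, Ultrafilter.mem_map]
    filter_upwards with j
    simpa using hR j)
  refine ⟨WeakDual.toStrongDual z, by simpa using hz, fun x => ?_⟩
  have h1 : Tendsto (fun j => StrongDual.toWeakDual (ζ j)) U (𝓝 z) := hle
  exact ((WeakDual.eval_continuous x).tendsto z).comp h1

theorem bp_norm_le {E : Type*} [NormedAddCommGroup E] [NormedSpace ℝ E] {J : Type*}
    (U : Ultrafilter J) (ζ : J → (E →L[ℝ] ℝ)) (z : E →L[ℝ] ℝ)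
    (h : ∀ x, Tendsto (fun j => ζ j x) U (𝓝 (z x))) (d : ℝ)
    (hd : Tendsto (fun j => ‖ζ j‖) U (𝓝 d)) : ‖z‖ ≤ d := by
  have hd0 : 0 ≤ d := ge_of_tendsto' hd fun j => norm_nonneg _
  refine z.opNorm_le_bound hd0 fun x => ?_
  exact le_of_tendsto_of_tendsto' (h x).norm (hd.mul_const ‖x‖) fun j => (ζ j).le_opNorm x

theorem bp_ultra_real {J : Type*} (U : Ultrafilter J) (a : J → ℝ) (A B : ℝ)
    (h : ∀ j, a j ∈ Icc A B) : ∃ b ∈ Icc A B, Tendsto a U (𝓝 b) := by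
  have hc := isCompact_Icc (a := A) (b := B)
  rw [isCompact_iff_ultrafilter_le_nhds] at hc
  obtain ⟨b, hb, hle⟩ := hc (U.map a) (by
    simp only [le_principal_iff, Ultrafilter.mem_coe, Ultrafilter.mem_map]
    filter_upwards with j
    exact h j)
  exact ⟨b, hb, hle⟩

/-- A Lipschitz, coercive, Fréchet-smooth function on a space with separable dual. -/
theorem bp_theta {E : Type*} [NormedAddCommGroup E] [NormedSpace ℝ E]
    [TopologicalSpace.SeparableSpace (E →L[ℝ] ℝ)] :
    ∃ θ : E → ℝ, Continuous θ ∧ θ 0 ≤ 0 ∧ (∀ y, ‖y‖ - 8 ≤ θ y) ∧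
      ∀ y, ∃ χ : E →L[ℝ] ℝ, ∀ ε > 0, ∃ δ > 0, ∀ h : E, ‖h‖ ≤ δ → θ (y + h) ≤ θ y + χ h + ε * ‖h‖ := by
  let B : Set (E →L[ℝ] ℝ) := closedBall 0 1
  have : Nonempty B := ⟨⟨0, by simp [B]⟩⟩
  have : SecondCountableTopology (E →L[ℝ] ℝ) := UniformSpace.secondCountable_of_separable _
  let ξ : ℕ → B := TopologicalSpace.denseSeq B
  have hξ1 : ∀ k, ‖(ξ k : E →L[ℝ] ℝ)‖ ≤ 1 := fun k => mem_closedBall_zero_iff.mp (ξ k).2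
  have hξd : ∀ z : E →L[ℝ] ℝ, ‖z‖ ≤ 1 → ∀ ε > 0, ∃ k, ‖z - ξ k‖ < ε := by
    intro z hz ε hε
    obtain ⟨k, hk⟩ := (TopologicalSpace.denseRange_denseSeq B).exists_dist_lt
      (⟨z, by simpa [B] using hz⟩ : B) hε
    refine ⟨k, ?_⟩
    rw [Subtype.dist_eq, dist_eq_norm] at hk
    exact hk
  let t : ℕ → (E →L[ℝ] ℝ) → ℝ := fun k z => (1/2:ℝ)^k * ‖z - ξ k‖^2
  have ht0 : ∀ k z, 0 ≤ t k z := fun k z => by positivity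
  have htle : ∀ k z, ‖z‖ ≤ 1 → t k z ≤ (1/2:ℝ)^k * 4 := by
    intro k z hz
    have h1 : ‖z - ξ k‖ ≤ 2 := (norm_sub_le _ _).trans (by linarith [hξ1 k])
    have h2 : ‖z - ξ k‖^2 ≤ 4 := by nlinarith [norm_nonneg (z - ξ k)]
    simp only [t]; gcongr
  have hgs : HasSum (fun k : ℕ => (1/2:ℝ)^k * 4) 8 := by
    have := hasSum_geometric_two.mul_right (4:ℝ)
    norm_num at this ⊢; exact this
  have hts : ∀ z, ‖z‖ ≤ 1 → Summable (fun k => t k z) := fun z hz =>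
    Summable.of_nonneg_of_le (fun k => ht0 k z) (fun k => htle k z hz) hgs.summable
  let Φ : (E →L[ℝ] ℝ) → ℝ := fun z => ∑' k, t k z
  have hΦ0 : ∀ z, 0 ≤ Φ z := fun z => tsum_nonneg fun k => ht0 k z
  have hΦ8 : ∀ z, ‖z‖ ≤ 1 → Φ z ≤ 8 := fun z hz => by
    rw [← hgs.tsum_eq]
    exact Summable.tsum_le_tsum (fun k => htle k z hz) (hts z hz) hgs.summable
  let θ : E → ℝ := fun y => ⨆ z : B, ((z : E →L[ℝ] ℝ) y - Φ z)
  have hB : ∀ z : B, ‖(z : E →L[ℝ] ℝ)‖ ≤ 1 := fun z => mem_closedBall_zero_iff.mp z.2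
  have hbd : ∀ (z : B) y, (z : E →L[ℝ] ℝ) y ≤ ‖y‖ := fun z y => by
    have := (z : E →L[ℝ] ℝ).le_opNorm y
    have h2 := le_abs_self ((z : E →L[ℝ] ℝ) y)
    rw [Real.norm_eq_abs] at this
    nlinarith [hB z, norm_nonneg y]
  have hbdd : ∀ y, BddAbove (range fun z : B => ((z : E →L[ℝ] ℝ) y - Φ z)) := by
    intro y
    refine ⟨‖y‖, ?_⟩
    rintro _ ⟨z, rfl⟩
    have := hbd z y
    have := hΦ0 z
    simp only; linarith
  have hle : ∀ y (z : E →L[ℝ] ℝ), ‖z‖ ≤ 1 → z y - Φ z ≤ θ y := fun y z hz =>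
    le_ciSup (hbdd y) (⟨z, by simpa [B] using hz⟩ : B)
  have hlip : ∀ y y', θ y ≤ θ y' + ‖y - y'‖ := by
    intro y y'
    refine ciSup_le fun z => ?_
    have h1 := hle y' z (hB z)
    have h2 := hbd z (y - y')
    rw [map_sub] at h2
    linarith
  refine ⟨θ, ?_, ?_, ?_, ?_⟩
  · have : LipschitzWith 1 θ := by
      refine LipschitzWith.of_dist_le_mul fun y y' => ?_
      rw [Real.dist_eq, abs_le, dist_eq_norm]
      have h1 := hlip y y'
      have h2 := hlip y' y
      rw [norm_sub_rev] at h2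
      constructor <;> simp <;> linarith
    exact this.continuous
  · refine ciSup_le fun z => ?_
    simp; exact hΦ0 z
  · intro y
    obtain ⟨z, hz, hzy⟩ := exists_dual_vector'' ℝ y
    have h1 := hle y z hz
    have h2 := hΦ8 z hz
    simp only [RCLike.ofReal_real_eq_id, id] at hzy
    linarith
  · intro y
    -- maximizer
    have hmax : ∃ χ : E →L[ℝ] ℝ, ‖χ‖ ≤ 1 ∧ θ y ≤ χ y - Φ χ := by
      have hseq : ∀ n : ℕ, ∃ z : B, θ y - 1 / ((n:ℝ)+1) < (z : E →L[ℝ] ℝ) y - Φ z := fun n =>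
        exists_lt_of_lt_ciSup (by
          have : (0:ℝ) < 1 / ((n:ℝ)+1) := by positivity
          show θ y - 1 / ((n:ℝ)+1) < θ y
          linarith)
      choose z hz using hseq
      let U : Ultrafilter ℕ := Ultrafilter.of atTop
      have hU : (U : Filter ℕ) ≤ atTop := Ultrafilter.of_le _
      obtain ⟨χ, hχ1, hχ⟩ := bp_weakstar U (fun n => (z n : E →L[ℝ] ℝ)) 1 (fun n => hB _)
      refine ⟨χ, hχ1, ?_⟩
      have hlim : Tendsto (fun n => (z n : E →L[ℝ] ℝ) y - (θ y - 1 / ((n:ℝ)+1))) U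
          (𝓝 (χ y - (θ y - 0))) :=
        (hχ y).sub (tendsto_const_nhds.sub (tendsto_one_div_add_atTop_nhds_zero_nat.mono_left hU))
      suffices Φ χ ≤ χ y - (θ y - 0) by linarith
      refine (hts χ hχ1).tsum_le_of_sum_range_le fun N => ?_
      have hk : ∀ k, ∃ b, Tendsto (fun n => t k (z n)) U (𝓝 b) ∧ t k χ ≤ b := by
        intro k
        obtain ⟨b, hb, hbt⟩ := bp_ultra_real U (fun n => ‖(z n : E →L[ℝ] ℝ) - ξ k‖) 0 2
          (fun n => ⟨norm_nonneg _, (norm_sub_le _ _).trans (by linarith [hξ1 k, hB (z n)])⟩)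
        refine ⟨(1/2:ℝ)^k * b^2, (hbt.pow 2).const_mul _, ?_⟩
        have : ‖χ - ξ k‖ ≤ b := bp_norm_le U _ _ (fun x => by
          simpa using (hχ x).sub_const ((ξ k : E →L[ℝ] ℝ) x)) b hbt
        simp only [t]; gcongr
      choose b hb1 hb2 using hk
      calc ∑ k ∈ Finset.range N, t k χ ≤ ∑ k ∈ Finset.range N, b k :=
            Finset.sum_le_sum fun k _ => hb2 k
        _ ≤ _ := by
          refine le_of_tendsto_of_tendsto' (tendsto_finsetSum _ fun k _ => hb1 k) hlim fun n => ?_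
          have h1 : ∑ k ∈ Finset.range N, t k (z n) ≤ Φ (z n) :=
            (hts _ (hB (z n))).sum_le_tsum _ fun k _ => ht0 k _
          linarith [hz n]
    obtain ⟨χ, hχ1, hχ⟩ := hmax
    refine ⟨χ, fun ε hε => ?_⟩
    -- strong maximum
    have hstrong : ∃ δ > 0, ∀ z : E →L[ℝ] ℝ, ‖z‖ ≤ 1 → θ y - δ ≤ z y - Φ z → ‖z - χ‖ ≤ ε / 2 := by
      obtain ⟨k, hk⟩ := hξd χ hχ1 (ε/8) (by positivity)
      refine ⟨(1/2:ℝ)^k * (ε/8)^2 / 2, by positivity, fun z hz hzy => ?_⟩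
      set δ := (1/2:ℝ)^k * (ε/8)^2 / 2 with hδ
      let mid : E →L[ℝ] ℝ := (1/2:ℝ) • (χ + z)
      have hmid1 : ‖mid‖ ≤ 1 := by
        simp only [mid, norm_smul]
        have := norm_add_le χ z
        norm_num; linarith
      have hmy : mid y = (χ y + z y)/2 := by simp [mid]; ring
      have h1 := hle y mid hmid1
      have hnm : ∀ j, ‖mid - ξ j‖ ≤ (‖χ - ξ j‖ + ‖z - ξ j‖)/2 := by
        intro j
        have : mid - ξ j = (1/2:ℝ) • ((χ - ξ j) + (z - ξ j)) := by
          simp only [mid]; module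
        rw [this, norm_smul]
        have := norm_add_le (χ - ξ j) (z - ξ j)
        norm_num at this ⊢; linarith
      have hconv : ∀ j, 0 ≤ (t j χ + t j z)/2 - t j mid := by
        intro j
        have hj := hnm j
        have : ‖mid - ξ j‖^2 ≤ (‖χ - ξ j‖^2 + ‖z - ξ j‖^2)/2 := by
          have : ‖mid - ξ j‖^2 ≤ ((‖χ - ξ j‖ + ‖z - ξ j‖)/2)^2 := by gcongr
          nlinarith [sq_nonneg (‖χ - ξ j‖ - ‖z - ξ j‖)]
        have h3 : (0:ℝ) ≤ (1/2:ℝ)^j := by positivity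
        simp only [t]
        nlinarith
      have hsum : HasSum (fun j => (t j χ + t j z)/2 - t j mid) ((Φ χ + Φ z)/2 - Φ mid) :=
        (((hts χ hχ1).hasSum.add (hts z hz).hasSum).div_const 2).sub (hts mid hmid1).hasSum
      have hkle : (t k χ + t k z)/2 - t k mid ≤ (Φ χ + Φ z)/2 - Φ mid :=
        le_hasSum hsum k fun j _ => hconv j
      have h5 : (t k χ + t k z)/2 - t k mid ≤ δ / 2 := by linarith
      have h6 : (1/2:ℝ)^k * ((‖χ - ξ k‖^2 + ‖z - ξ k‖^2)/2 - ‖mid - ξ k‖^2)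
          ≤ (1/2:ℝ)^k * ((ε/8)^2/4) := by
        simp only [t] at h5; rw [hδ] at h5; linarith
      have h7 := le_of_mul_le_mul_left h6 (by positivity)
      have h8 : ‖mid - ξ k‖^2 ≤ ((‖χ - ξ k‖ + ‖z - ξ k‖)/2)^2 := by
        have := hnm k
        gcongr
      have h9 : (‖z - ξ k‖ - ‖χ - ξ k‖)^2 ≤ (ε/8)^2 := by nlinarith
      have h10 := abs_le_of_sq_le_sq h9 (by positivity)
      have h11 : ‖z - χ‖ ≤ ‖z - ξ k‖ + ‖χ - ξ k‖ := by
        have := norm_sub_le (z - (ξ k : E →L[ℝ] ℝ)) (χ - ξ k)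
        simpa using this
      linarith [(abs_le.mp h10).2]
    obtain ⟨δ, hδ, hst⟩ := hstrong
    refine ⟨min (δ/3) (min (ε/2) 1), by positivity, fun h hh => ?_⟩
    have hh1 : ‖h‖ ≤ δ/3 := hh.trans (min_le_left _ _)
    have hh2 : ‖h‖ ≤ ε/2 := hh.trans ((min_le_right _ _).trans (min_le_left _ _))
    have hh3 : ‖h‖ ≤ 1 := hh.trans ((min_le_right _ _).trans (min_le_right _ _))
    rcases eq_or_ne h 0 with rfl | hne
    · simp
    have hpos : 0 < ‖h‖ := norm_pos_iff.mpr hne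
    obtain ⟨z, hz⟩ : ∃ z : B, θ (y + h) - ‖h‖^2 < (z : E →L[ℝ] ℝ) (y + h) - Φ z :=
      exists_lt_of_lt_ciSup (by
        show θ (y + h) - ‖h‖^2 < θ (y + h)
        have : 0 < ‖h‖^2 := by positivity
        linarith)
    rw [map_add] at hz
    have h1 := hlip y (y + h)
    have h1' : ‖y - (y + h)‖ = ‖h‖ := by simp
    have h2 := hbd z h
    have h4 : ‖h‖^2 ≤ ‖h‖ := by nlinarith
    have h3 := hst z (hB z) (by linarith)
    have h5 := hle y z (hB z)
    have h6 : ((z : E →L[ℝ] ℝ) - χ) h ≤ ε/2 * ‖h‖ := by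
      have := ((z : E →L[ℝ] ℝ) - χ).le_of_opNorm_le h3 h
      exact (le_abs_self _).trans this
    have h7 : ((z : E →L[ℝ] ℝ) - χ) h = (z : E →L[ℝ] ℝ) h - χ h := rfl
    have h8 : ‖h‖^2 ≤ ε/2 * ‖h‖ := by nlinarith
    linarith


theorem bp_pow_unif (p : ℝ) (hp : 0 ≤ p) (R τ : ℝ) (hτ : 0 < τ) :
    ∃ γ > 0, ∀ a ∈ Icc 0 R, ∀ b ∈ Icc 0 R, |a - b| ≤ γ → |a ^ p - b ^ p| ≤ τ := by
  have hc : ContinuousOn (fun x : ℝ => x ^ p) (Icc 0 R) :=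
    (Real.continuous_rpow_const hp).continuousOn
  have hu := isCompact_Icc.uniformContinuousOn_of_continuous hc
  rw [Metric.uniformContinuousOn_iff_le] at hu
  obtain ⟨γ, hγ, h⟩ := hu τ hτ
  exact ⟨γ, hγ, fun a ha b hb hab => h a ha b hb hab⟩

theorem bp_pow_bound (p : ℝ) (hp : 1 ≤ p) (σ : ℝ) (hσ : 0 < σ) (m M : ℝ) :
    ∃ R, 0 ≤ R ∧ ∀ x, 0 ≤ x → m + σ * x ^ p ≤ M → x ≤ R := by
  refine ⟨max 1 ((M - m) / σ), by positivity, fun x hx h => ?_⟩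
  rcases le_total x 1 with h1 | h1
  · exact h1.trans (le_max_left _ _)
  · refine le_trans ?_ (le_max_right _ _)
    rw [le_div_iff₀ hσ]
    have : x ≤ x ^ p := Real.self_le_rpow_of_one_le h1 hp
    nlinarith

theorem bp_second_diff (p : ℝ) (hp : 1 ≤ p) (r₀ R₁ τ : ℝ) (hr : 0 < r₀) (hτ : 0 < τ) :
    ∃ s₀ > 0, s₀ ≤ r₀ / 2 ∧ ∀ s, 0 < s → s ≤ s₀ → ∀ R, r₀ ≤ R → R ≤ R₁ →
      (R + s) ^ p - R ^ p ≤ R ^ p - (R - s) ^ p + τ * s ∧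
      (r₀ / 2) ^ (p - 1) * s ≤ R ^ p - (R - s) ^ p := by
  have hp0 : 0 < p := by linarith
  obtain ⟨γ, hγ, hu⟩ := bp_pow_unif (p - 1) (by linarith) (R₁ + r₀) (τ / p) (by positivity)
  refine ⟨min (r₀/2) (γ/2), by positivity, min_le_left _ _, fun s hs hs0 R hR hR1 => ?_⟩
  have hs1 : s ≤ r₀/2 := hs0.trans (min_le_left _ _)
  have hs2 : s ≤ γ/2 := hs0.trans (min_le_right _ _)
  have hder : ∀ x : ℝ, HasDerivAt (fun x : ℝ => x ^ p) (p * x ^ (p - 1)) x := fun x =>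
    Real.hasDerivAt_rpow_const (Or.inr hp)
  have hcont : ∀ S : Set ℝ, ContinuousOn (fun x : ℝ => x ^ p) S := fun S =>
    (Real.continuous_rpow_const hp0.le).continuousOn
  obtain ⟨a, ⟨ha1, ha2⟩, ha⟩ := exists_hasDerivAt_eq_slope (fun x : ℝ => x ^ p)
    (fun x => p * x ^ (p - 1)) (show R - s < R by linarith) (hcont _) (fun x _ => hder x)
  obtain ⟨b, ⟨hb1, hb2⟩, hb⟩ := exists_hasDerivAt_eq_slope (fun x : ℝ => x ^ p)
    (fun x => p * x ^ (p - 1)) (show R < R + s by linarith) (hcont _) (fun x _ => hder x)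
  simp only [sub_sub_cancel, add_sub_cancel_left] at ha hb
  rw [eq_div_iff hs.ne'] at ha hb
  have hab := hu b ⟨by linarith, by linarith⟩ a ⟨by linarith, by linarith⟩
    (by rw [abs_le]; constructor <;> linarith)
  have hab' : p * b ^ (p-1) - p * a ^ (p-1) ≤ τ := by
    have := (abs_le.mp hab).2
    rw [le_div_iff₀ hp0] at this
    linarith
  constructor
  · nlinarith
  · rw [← ha]
    have h1 : (r₀/2) ^ (p-1) ≤ a ^ (p-1) :=
      Real.rpow_le_rpow (by positivity) (by linarith) (by linarith)
    have h2 : 0 ≤ a ^ (p-1) := Real.rpow_nonneg (by linarith) _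
    have : (r₀/2) ^ (p-1) ≤ p * a ^ (p-1) := by nlinarith
    gcongr

noncomputable def bpF {E I : Type*} [NormedAddCommGroup E] (φ : I → ℝ) (w : I → E) (σ p : ℝ)
    (η : E) (i : I) : ℝ := φ i + σ * ‖w i - η‖ ^ p

noncomputable def bpG {E I : Type*} [NormedAddCommGroup E] (φ : I → ℝ) (w : I → E) (σ p : ℝ)
    (η : E) : ℝ := ⨅ i, bpF φ w σ p η i

section
variable {E I : Type*} [NormedAddCommGroup E] {φ : I → ℝ} {w : I → E} {σ p m : ℝ}

theorem bpF_ge (hσ : 0 < σ) (hm : ∀ i, m ≤ φ i) (η : E) (i : I) : m ≤ bpF φ w σ p η i := by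
  have : 0 ≤ σ * ‖w i - η‖ ^ p := by positivity
  have := hm i
  simp only [bpF]; linarith

theorem bpG_le (hσ : 0 < σ) (hm : ∀ i, m ≤ φ i) (η : E) (i : I) :
    bpG φ w σ p η ≤ bpF φ w σ p η i :=
  ciInf_le ⟨m, by rintro _ ⟨j, rfl⟩; exact bpF_ge hσ hm η j⟩ i

theorem bpG_ge [Nonempty I] (hσ : 0 < σ) (hm : ∀ i, m ≤ φ i) (η : E) : m ≤ bpG φ w σ p η :=
  le_ciInf fun i => bpF_ge hσ hm η i

theorem bpG_lt [Nonempty I] (η : E) (δ : ℝ) (hδ : 0 < δ) :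
    ∃ i, bpF φ w σ p η i < bpG φ w σ p η + δ :=
  exists_lt_of_ciInf_lt (by show bpG φ w σ p η < _; linarith)

theorem bpF_unif (hσ : 0 < σ) (hp : 1 ≤ p) (hm : ∀ i, m ≤ φ i) (M τ : ℝ) (hτ : 0 < τ) :
    ∃ γ > 0, ∀ η η' i, ‖η - η'‖ ≤ γ → bpF φ w σ p η i ≤ M →
      bpF φ w σ p η' i ≤ bpF φ w σ p η i + τ := by
  obtain ⟨R, hR0, hR⟩ := bp_pow_bound p hp σ hσ m M
  obtain ⟨γ, hγ, hu⟩ := bp_pow_unif p (by linarith) (R + 1) (τ / σ) (by positivity)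
  refine ⟨min γ 1, by positivity, fun η η' i hd hM => ?_⟩
  have h1 : ‖w i - η‖ ≤ R := hR _ (norm_nonneg _) (by
    have := hm i; simp only [bpF] at hM; linarith)
  have h2 : |‖w i - η'‖ - ‖w i - η‖| ≤ ‖η - η'‖ := by
    have := abs_norm_sub_norm_le (w i - η') (w i - η)
    simpa using this
  have h3 := hd.trans (min_le_left _ _)
  have h4 := hd.trans (min_le_right _ _)
  have h5 := abs_le.mp h2
  have h6 := hu ‖w i - η'‖ ⟨norm_nonneg _, by linarith⟩ ‖w i - η‖ ⟨norm_nonneg _, by linarith⟩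
    (h2.trans h3)
  have h7 := (abs_le.mp h6).2
  rw [le_div_iff₀ hσ] at h7
  simp only [bpF]
  linarith

theorem bpG_continuous [Nonempty I] (hσ : 0 < σ) (hp : 1 ≤ p) (hm : ∀ i, m ≤ φ i) :
    Continuous (bpG φ w σ p) := by
  rw [Metric.continuous_iff]
  intro η τ hτ
  obtain ⟨γ, hγ, h⟩ := bpF_unif (w := w) hσ hp hm (bpG φ w σ p η + τ) (τ/4) (by positivity)
  refine ⟨γ, hγ, fun η' hd => ?_⟩
  rw [dist_eq_norm] at hd
  obtain ⟨i, hi⟩ := bpG_lt (φ := φ) (w := w) (σ := σ) (p := p) η (τ/4) (by positivity)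
  have h1 := h η η' i (by rw [norm_sub_rev]; exact hd.le) (by linarith)
  have h2 := bpG_le (w := w) (p := p) hσ hm η' i
  obtain ⟨j, hj⟩ := bpG_lt (φ := φ) (w := w) (σ := σ) (p := p) η' (τ/4) (by positivity)
  have h3 := h η' η j hd.le (by linarith)
  have h4 := bpG_le (w := w) (p := p) hσ hm η j
  rw [Real.dist_eq, abs_lt]
  constructor <;> linarith

end

def bpO {E I : Type*} [NormedAddCommGroup E] [NormedSpace ℝ E] (φ : I → ℝ) (w : I → E) (σ p : ℝ)
    (ε : ℝ) : Set E :=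
  {η | ∃ l : E →L[ℝ] ℝ, ‖l‖ ≤ 1 ∧ ∃ δ > 0, ∀ i, bpF φ w σ p η i ≤ bpG φ w σ p η + δ →
    ‖w i - η‖ - ε ≤ l (w i - η)}

section
variable {E I : Type*} [NormedAddCommGroup E] [NormedSpace ℝ E] {φ : I → ℝ} {w : I → E} {σ p m : ℝ}

theorem bpO_open [Nonempty I] (hσ : 0 < σ) (hp : 1 ≤ p) (hm : ∀ i, m ≤ φ i) (ε : ℝ) (hε : 0 < ε) :
    bpO φ w σ p ε ⊆ interior (bpO φ w σ p (2 * ε)) := by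
  rintro η ⟨l, hl, δ, hδ, h⟩
  rw [mem_interior_iff_mem_nhds, Metric.mem_nhds_iff]
  have hc := bpG_continuous (w := w) hσ hp hm
  rw [Metric.continuous_iff] at hc
  obtain ⟨γ₁, hγ₁, h1⟩ := hc η (δ/3) (by positivity)
  obtain ⟨γ₂, hγ₂, h2⟩ := bpF_unif (w := w) hσ hp hm (bpG φ w σ p η + δ) (δ/3) (by positivity)
  refine ⟨min γ₁ (min γ₂ (ε/2)), by positivity, fun η' hη' => ?_⟩
  rw [mem_ball] at hη'
  have d1 := hη'.trans_le (min_le_left _ _)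
  have d2 := hη'.trans_le ((min_le_right _ _).trans (min_le_left _ _))
  have d3 := hη'.trans_le ((min_le_right _ _).trans (min_le_right _ _))
  have h3 := h1 η' d1
  rw [Real.dist_eq, abs_lt] at h3
  rw [dist_eq_norm] at d2 d3
  refine ⟨l, hl, δ/3, by positivity, fun i hi => ?_⟩
  have h4 := h2 η' η i d2.le (by linarith)
  have h5 := h i (by linarith)
  have h6 : l (w i - η) = l (w i - η') + l (η' - η) := by rw [← map_add]; congr 1; abel
  have h7 : l (η' - η) ≤ ‖η' - η‖ := by
    have := l.le_of_opNorm_le hl (η' - η)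
    rw [one_mul] at this
    exact (le_abs_self _).trans this
  have h8 : ‖w i - η'‖ ≤ ‖w i - η‖ + ‖η' - η‖ := by
    have := norm_sub_le (w i - η) (η' - η)
    simpa using this
  linarith

set_option maxHeartbeats 1000000 in
theorem bpO_near [CompleteSpace E] [TopologicalSpace.SeparableSpace (E →L[ℝ] ℝ)] [Nonempty I]
    (hσ : 0 < σ) (hp : 1 ≤ p) (hm : ∀ i, m ≤ φ i) (ε : ℝ) (hε : 0 < ε) (c : E) (r : ℝ) (hr : 0 < r) :
    ∃ η ∈ bpO φ w σ p ε, ‖η - c‖ ≤ r := by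
  obtain ⟨θ, hθc, hθ0, hθ8, hθd⟩ := bp_theta (E := E)
  set g := bpG φ w σ p with hg
  have hgc : Continuous g := bpG_continuous hσ hp hm
  have hgm : ∀ x, m ≤ g x := fun x => bpG_ge hσ hm x
  set L : ℝ := (g c - m + 8) / r with hL
  have hL0 : 0 < L := by have := hgm c; rw [hL]; apply div_pos <;> linarith
  obtain ⟨R₁, hR₁0, hR₁⟩ := bp_pow_bound p hp σ hσ m (g c + 9)
  set r₀ := ε / 2 with hr₀
  have hr₀0 : 0 < r₀ := by positivity
  set A := σ * (r₀ / 2) ^ (p - 1) with hA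
  have hA0 : 0 < A := by positivity
  set κ := min (A / 6) (ε * A / (14 * (R₁ + 1))) with hκ
  have hκ0 : 0 < κ := by positivity
  have hκ1 : κ ≤ A / 6 := min_le_left _ _
  have hκ2 : 7 * κ * R₁ ≤ ε * A / 2 := by
    have : κ ≤ ε * A / (14 * (R₁ + 1)) := min_le_right _ _
    rw [le_div_iff₀ (by positivity)] at this
    nlinarith
  obtain ⟨s₀, hs₀, hs₀r, hsd⟩ := bp_second_diff p hp r₀ R₁ (κ / σ) hr₀0 (by positivity)
  obtain ⟨η, hη1, hη2⟩ := bp_ekeland (fun x => g x + θ (L • (x - c)))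
    (hgc.add (hθc.comp (by fun_prop))) (m - 8)
    (fun x => by have := hgm x; have := hθ8 (L • (x - c)); have := norm_nonneg (L • (x - c)); linarith)
    c κ hκ0
  simp only [sub_self, smul_zero] at hη1
  have hθη := hθ8 (L • (η - c))
  have hnL : ‖L • (η - c)‖ = L * ‖η - c‖ := by rw [norm_smul, Real.norm_of_nonneg hL0.le]
  rw [hnL] at hθη
  have hdist : ‖η - c‖ ≤ r := by
    have h1 : L * ‖η - c‖ ≤ L * r := by
      have : L * r = g c - m + 8 := by rw [hL]; field_simp
      have := hgm η
      linarith
    exact le_of_mul_le_mul_left h1 hL0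
  have hgη : g η ≤ g c + 8 := by
    have : 0 ≤ L * ‖η - c‖ := by positivity
    linarith
  obtain ⟨χ, hχ⟩ := hθd (L • (η - c))
  obtain ⟨δ₁, hδ₁, hχ⟩ := hχ (κ / L) (by positivity)
  set ξ : E →L[ℝ] ℝ := -(L • χ) with hξ
  have hsub : ∀ h : E, L * ‖h‖ ≤ δ₁ → g η + ξ h - 2 * κ * ‖h‖ ≤ g (η + h) := by
    intro h hh
    have h1 := hη2 (η + h)
    have h2 := hχ (L • h) (by rw [norm_smul, Real.norm_of_nonneg hL0.le]; exact hh)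
    rw [norm_smul, Real.norm_of_nonneg hL0.le] at h2
    have h3 : L • (η + h - c) = L • (η - c) + L • h := by rw [← smul_add]; congr 1; abel
    have h4 : κ / L * (L * ‖h‖) = κ * ‖h‖ := by field_simp
    have h5 : dist η (η + h) = ‖h‖ := by simp
    have h6 : ξ h = - χ (L • h) := by simp [hξ]
    simp only [h3, h5] at h1
    rw [h4] at h2
    linarith
  set s := min s₀ (δ₁ / L) with hs
  have hs0 : 0 < s := by positivity
  have hss₀ : s ≤ s₀ := min_le_left _ _
  have hsL : L * s ≤ δ₁ := by
    have : s ≤ δ₁ / L := min_le_right _ _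
    rw [le_div_iff₀ hL0] at this
    linarith
  set l : E →L[ℝ] ℝ := -(‖ξ‖⁻¹ • ξ) with hl
  have hl1 : ‖l‖ ≤ 1 := by
    rw [hl, norm_neg, norm_smul, norm_inv, norm_norm]
    exact inv_mul_le_one
  refine ⟨η, ⟨l, hl1, min 1 (κ * s), by positivity, fun i hi => ?_⟩, hdist⟩
  rw [← hg] at hi
  have hi1 : bpF φ w σ p η i ≤ g η + 1 := hi.trans (by gcongr; exact min_le_left _ _)
  have hi2 : bpF φ w σ p η i ≤ g η + κ * s := hi.trans (by gcongr; exact min_le_right _ _)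
  set z := w i - η with hz
  have hRR : ‖z‖ ≤ R₁ := hR₁ _ (norm_nonneg _) (by
    have := hm i; simp only [bpF, ← hz] at hi1; linarith)
  rcases le_or_gt ‖z‖ r₀ with hsmall | hbig
  · have h1 := l.le_of_opNorm_le hl1 z
    rw [one_mul, Real.norm_eq_abs, abs_le] at h1
    linarith [h1.1]
  obtain ⟨hd1, hd2⟩ := hsd s hs0 hss₀ ‖z‖ hbig.le hRR
  have hR0 : 0 < ‖z‖ := hr₀0.trans hbig
  set D := ‖z‖ ^ p - (‖z‖ - s) ^ p with hD
  have hmain : ∀ h : E, ‖h‖ = s → ξ h ≤ 3 * κ * s + σ * (‖z - h‖ ^ p - ‖z‖ ^ p) := by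
    intro h hh
    have h1 := hsub h (by rw [hh]; exact hsL)
    have h2 : g (η + h) ≤ bpF φ w σ p (η + h) i := bpG_le hσ hm _ i
    have h3 : w i - (η + h) = z - h := by rw [hz]; abel
    simp only [bpF, h3] at h2
    simp only [bpF, ← hz] at hi2
    rw [hh] at h1
    linarith
  -- upper bound for the norm
  have hD1 : σ * ((‖z‖ + s) ^ p - ‖z‖ ^ p) ≤ σ * D + κ * s := by
    have := mul_le_mul_of_nonneg_left hd1 hσ.le
    have h2 : σ * (D + κ / σ * s) = σ * D + κ * s := by field_simp
    linarith
  have hD2 : A * s ≤ σ * D := by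
    have := mul_le_mul_of_nonneg_left hd2 hσ.le
    rw [hA]; linarith
  have hup : ∀ h : E, ‖h‖ = s → ξ h ≤ σ * D + 4 * κ * s := by
    intro h hh
    have h1 := hmain h hh
    have h2 : ‖z - h‖ ^ p ≤ (‖z‖ + s) ^ p :=
      Real.rpow_le_rpow (norm_nonneg _) ((norm_sub_le _ _).trans (by rw [hh])) (by linarith)
    have h3 : σ * (‖z - h‖ ^ p - ‖z‖ ^ p) ≤ σ * ((‖z‖ + s) ^ p - ‖z‖ ^ p) := by gcongr
    linarith
  have hBnn : 0 ≤ (σ * D + 4 * κ * s) / s := by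
    have : 0 < A * s := by positivity
    have : 0 < κ * s := by positivity
    apply div_nonneg <;> linarith
  have hnorm : ‖ξ‖ ≤ (σ * D + 4 * κ * s) / s := by
    have key : ∀ x : E, ξ x ≤ (σ * D + 4 * κ * s) / s * ‖x‖ := by
      intro x
      rcases eq_or_ne x 0 with rfl | hx
      · simp
      have hx0 : 0 < ‖x‖ := norm_pos_iff.mpr hx
      have h1 := hup ((s / ‖x‖) • x) (by
        rw [norm_smul, Real.norm_of_nonneg (by positivity)]; field_simp)
      rw [map_smul, smul_eq_mul, div_mul_eq_mul_div, div_le_iff₀ hx0] at h1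
      rw [div_mul_eq_mul_div, le_div_iff₀ hs0]
      linarith
    refine ξ.opNorm_le_bound hBnn fun x => ?_
    rw [Real.norm_eq_abs, abs_le]
    have h1 := key x
    have h2 := key (-x)
    rw [map_neg, norm_neg] at h2
    constructor <;> linarith
  rw [le_div_iff₀ hs0] at hnorm
  -- lower bound
  have hlow : ‖z‖ * (σ * D - 3 * κ * s) ≤ - ξ z * s := by
    have hst : s < ‖z‖ := by linarith
    have h1 := hmain ((s / ‖z‖) • z) (by
        rw [norm_smul, Real.norm_of_nonneg (by positivity)]; field_simp)
    have h2 : ‖z - (s / ‖z‖) • z‖ = ‖z‖ - s := by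
      have : z - (s / ‖z‖) • z = (1 - s / ‖z‖) • z := by module
      rw [this, norm_smul, Real.norm_of_nonneg (by
        rw [sub_nonneg, div_le_one hR0]; exact hst.le)]
      field_simp
    rw [h2, map_smul, smul_eq_mul, div_mul_eq_mul_div, div_le_iff₀ hR0] at h1
    nlinarith
  have hξz : - ξ z ≤ ‖ξ‖ * ‖z‖ := by
    have := ξ.le_opNorm z
    rw [Real.norm_eq_abs, abs_le] at this
    linarith [this.1]
  have hn1 : A - 3 * κ ≤ ‖ξ‖ := by
    have h1 : ‖z‖ * ((A - 3 * κ) * s) ≤ ‖z‖ * (‖ξ‖ * s) := by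
      calc ‖z‖ * ((A - 3 * κ) * s) ≤ ‖z‖ * (σ * D - 3 * κ * s) := by gcongr; linarith
        _ ≤ - ξ z * s := hlow
        _ ≤ (‖ξ‖ * ‖z‖) * s := by gcongr
        _ = ‖z‖ * (‖ξ‖ * s) := by ring
    exact le_of_mul_le_mul_right (le_of_mul_le_mul_left h1 hR0) hs0
  have hξ0 : 0 < ‖ξ‖ := by linarith
  have hz1 : ‖z‖ * (‖ξ‖ - 7 * κ) ≤ - ξ z := by
    refine le_of_mul_le_mul_right ?_ hs0
    refine le_trans ?_ hlow
    rw [mul_assoc]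
    gcongr
    linarith
  have hlz : l z = - ξ z / ‖ξ‖ := by
    simp [hl]; field_simp
  rw [hlz, le_div_iff₀ hξ0]
  have h9 : 7 * κ * ‖z‖ ≤ ε * ‖ξ‖ := by
    calc 7 * κ * ‖z‖ ≤ 7 * κ * R₁ := by gcongr
      _ ≤ ε * A / 2 := hκ2
      _ ≤ ε * ‖ξ‖ := by nlinarith
  linarith

theorem bpO_dense [CompleteSpace E] [TopologicalSpace.SeparableSpace (E →L[ℝ] ℝ)] [Nonempty I]
    (hσ : 0 < σ) (hp : 1 ≤ p) (hm : ∀ i, m ≤ φ i) (c : E) (r : ℝ) (hr : 0 < r) :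
    ∃ η, ‖η - c‖ < r ∧ ∀ ε > 0, η ∈ bpO φ w σ p ε := by
  have hd : Dense (⋂ n : ℕ, interior (bpO φ w σ p (2 * (1 / ((n:ℝ) + 1))))) := by
    refine dense_iInter_of_isOpen_nat (fun n => isOpen_interior) fun n => ?_
    refine Dense.mono (bpO_open hσ hp hm (1 / ((n:ℝ)+1)) (by positivity)) ?_
    rw [Metric.dense_iff]
    intro x ρ hρ
    obtain ⟨η, hη, hd⟩ := bpO_near (w := w) hσ hp hm (1 / ((n:ℝ)+1)) (by positivity) x (ρ/2) (by positivity)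
    exact ⟨η, by rw [mem_ball, dist_eq_norm]; linarith, hη⟩
  obtain ⟨η, hη, hd⟩ := hd.exists_dist_lt c hr
  refine ⟨η, by rwa [dist_comm, dist_eq_norm] at hd, fun ε hε => ?_⟩
  obtain ⟨n, hn⟩ := exists_nat_one_div_lt (half_pos hε)
  rw [mem_iInter] at hη
  obtain ⟨l, hl, δ, hδ, h⟩ := interior_subset (hη n)
  exact ⟨l, hl, δ, hδ, fun i hi => by linarith [h i hi]⟩

end


theorem bp_annih {Z : Type*} [NormedAddCommGroup Z] [NormedSpace ℝ Z] (F : Submodule ℝ Z)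
    (hF : IsClosed (F : Set Z)) (ζ : Z) (hζ : ζ ∉ F) :
    ∃ φ : Z →L[ℝ] ℝ, (∀ b ∈ F, φ b = 0) ∧ φ ζ ≠ 0 := by
  obtain ⟨φ, u, h1, h2⟩ := geometric_hahn_banach_point_closed (x := ζ) F.convex hF hζ
  have hu : u < 0 := by simpa using h2 0 F.zero_mem
  refine ⟨φ, fun b hb => ?_, by linarith⟩
  by_contra hne
  have h3 := h2 (((u - 1) / φ b) • b) (F.smul_mem _ hb)
  rw [map_smul, smul_eq_mul, div_mul_cancel₀ _ hne] at h3
  linarith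

theorem bp_sep_dual {X : Type*} [NormedAddCommGroup X] [NormedSpace ℝ X]
    (hRefl : Function.Surjective ⇑(NormedSpace.inclusionInDoubleDual ℝ X))
    (Y : Submodule ℝ X) (hYc : IsClosed (Y : Set X)) [TopologicalSpace.SeparableSpace Y] :
    TopologicalSpace.SeparableSpace (Y →L[ℝ] ℝ) := by
  let x : ℕ → Y := TopologicalSpace.denseSeq Y
  have hx : ∀ k, ∃ g : Y →L[ℝ] ℝ, ‖g‖ ≤ 1 ∧ g (x k) = ‖x k‖ := fun k => by
    simpa using exists_dual_vector'' ℝ (x k)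
  choose ξ hξ1 hξ2 using hx
  let F : Submodule ℝ (Y →L[ℝ] ℝ) := (Submodule.span ℝ (range ξ)).topologicalClosure
  have hFc : IsClosed (F : Set (Y →L[ℝ] ℝ)) := Submodule.isClosed_topologicalClosure _
  have hsep : TopologicalSpace.IsSeparable (F : Set (Y →L[ℝ] ℝ)) := by
    have : TopologicalSpace.IsSeparable (Submodule.span ℝ (range ξ) : Set (Y →L[ℝ] ℝ)) :=
      (countable_range ξ).isSeparable.span
    exact this.closure
  have hξF : ∀ k, ξ k ∈ F := fun k =>
    Submodule.le_topologicalClosure _ (Submodule.subset_span ⟨k, rfl⟩)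
  have htop : (F : Set (Y →L[ℝ] ℝ)) = univ := by
    rw [eq_univ_iff_forall]
    intro ζ
    by_contra hζ
    obtain ⟨φ, hφ0, hφ⟩ := bp_annih F hFc ζ hζ
    let rs : (X →L[ℝ] ℝ) →L[ℝ] (Y →L[ℝ] ℝ) := (ContinuousLinearMap.compL ℝ Y X ℝ).flip Y.subtypeL
    obtain ⟨y, hy⟩ := hRefl (φ.comp rs)
    have hy' : ∀ l : X →L[ℝ] ℝ, l y = φ (l.comp Y.subtypeL) := by
      intro l
      have := congrArg (fun T => T l) hy
      exact this
    have hyY : y ∈ Y := by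
      by_contra hn
      obtain ⟨l, hl0, hl⟩ := bp_annih Y hYc y hn
      apply hl
      rw [hy']
      have : l.comp Y.subtypeL = 0 := by
        ext b; simpa using hl0 b b.2
      rw [this, map_zero]
    have hext : ∀ l : Y →L[ℝ] ℝ, φ l = l ⟨y, hyY⟩ := by
      intro l
      obtain ⟨l', hl', _⟩ := exists_extension_norm_eq Y l
      have : l'.comp Y.subtypeL = l := by
        ext b; exact hl' b
      rw [← this, ← hy']
      rfl
    have hy0 : (⟨y, hyY⟩ : Y) ≠ 0 := by
      intro h0
      apply hφ
      rw [hext, h0, map_zero]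
    obtain ⟨k, hk⟩ := (TopologicalSpace.denseRange_denseSeq Y).exists_dist_lt
      (⟨y, hyY⟩ : Y) (half_pos (norm_pos_iff.mpr hy0))
    rw [dist_eq_norm] at hk
    change ‖_ - x k‖ < _ at hk
    have h1 : ξ k ⟨y, hyY⟩ = 0 := by rw [← hext]; exact hφ0 _ (hξF k)
    have h2 : ξ k (x k - ⟨y, hyY⟩) = ‖x k‖ := by rw [map_sub, h1, hξ2, sub_zero]
    have h3 := (ξ k).le_of_opNorm_le (hξ1 k) (x k - ⟨y, hyY⟩)
    rw [h2, norm_norm, one_mul, norm_sub_rev] at h3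
    have h4 := norm_sub_norm_le (⟨y, hyY⟩ : Y) (x k)
    linarith
  rw [htop] at hsep
  exact TopologicalSpace.isSeparable_univ_iff.mp hsep

section
variable {E I : Type*} [NormedAddCommGroup E] [NormedSpace ℝ E] {φ : I → ℝ} {w : I → E} {σ p m : ℝ}

theorem bp_approx_closure [Nonempty I] (hσ : 0 < σ) (hp : 1 ≤ p) (hm : ∀ i, m ≤ φ i)
    (D : Set E) (J : Set I)
    (h : ∀ η ∈ D, ∀ δ > 0, ∃ i ∈ J, bpF φ w σ p η i < bpG φ w σ p η + δ) :
    ∀ η ∈ closure D, ∀ δ > 0, ∃ i ∈ J, bpF φ w σ p η i < bpG φ w σ p η + δ := by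
  intro η hη δ hδ
  have hc := bpG_continuous (w := w) hσ hp hm
  rw [Metric.continuous_iff] at hc
  obtain ⟨γ₁, hγ₁, h1⟩ := hc η (δ/4) (by positivity)
  obtain ⟨γ₂, hγ₂, h2⟩ := bpF_unif (w := w) hσ hp hm (bpG φ w σ p η + δ) (δ/4) (by positivity)
  obtain ⟨η', hη', hd⟩ := Metric.mem_closure_iff.mp hη (min γ₁ γ₂) (by positivity)
  have d1 := hd.trans_le (min_le_left _ _)
  have d2 := hd.trans_le (min_le_right _ _)
  have h3 := h1 η' (by rwa [dist_comm])
  rw [Real.dist_eq, abs_lt] at h3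
  obtain ⟨i, hiJ, hi⟩ := h η' hη' (δ/4) (by positivity)
  have h4 := h2 η' η i (by rw [← dist_eq_norm, dist_comm]; exact d2.le) (by linarith)
  exact ⟨i, hiJ, by linarith⟩

theorem bp_rich [Nonempty I] (hσ : 0 < σ) (hp : 1 ≤ p) (hm : ∀ i, m ≤ φ i) (a : E) :
    ∃ Y : Submodule ℝ E, IsClosed (Y : Set E) ∧ TopologicalSpace.IsSeparable (Y : Set E) ∧ a ∈ Y ∧
      ∀ η ∈ Y, ∀ δ > 0, ∃ i, w i ∈ Y ∧ bpF φ w σ p η i < bpG φ w σ p η + δ := by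
  let Q := {M : Submodule ℝ E // TopologicalSpace.IsSeparable (M : Set E)}
  have step : ∀ M : Q, ∃ M' : Q, M.1 ≤ M'.1 ∧
      ∀ η ∈ M.1, ∀ δ > 0, ∃ i, w i ∈ M'.1 ∧ bpF φ w σ p η i < bpG φ w σ p η + δ := by
    rintro ⟨M, hM⟩
    obtain ⟨D, hDM, hDc, hDd⟩ := hM.exists_countable_dense_subset
    have hi : ∀ (η : E) (n : ℕ), ∃ i, bpF φ w σ p η i < bpG φ w σ p η + 1 / ((n:ℝ)+1) :=
      fun η n => bpG_lt η _ (by positivity)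
    choose i hi using hi
    let T : Set E := ⋃ n : ℕ, (fun η => w (i η n)) '' D
    have hT : T.Countable := countable_iUnion fun n => hDc.image _
    refine ⟨⟨Submodule.span ℝ ((M : Set E) ∪ T), (hM.union hT.isSeparable).span⟩, ?_, ?_⟩
    · intro y hy
      exact Submodule.subset_span (Or.inl hy)
    · have := bp_approx_closure (w := w) hσ hp hm D
        {i | w i ∈ Submodule.span ℝ ((M : Set E) ∪ T)} (by
          intro η hη δ hδ
          obtain ⟨n, hn⟩ := exists_nat_one_div_lt hδ
          refine ⟨i η n, ?_, by linarith [hi η n]⟩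
          exact Submodule.subset_span (Or.inr (mem_iUnion.mpr ⟨n, η, hη, rfl⟩)))
      exact fun η hη => this η (hDd hη)
  choose nx hnx1 hnx2 using step
  let q0 : Q := ⟨Submodule.span ℝ {a}, (countable_singleton a).isSeparable.span⟩
  let q : ℕ → Q := fun n => Nat.rec q0 (fun _ M => nx M) n
  have hmono : Monotone (fun n => (q n).1) := monotone_nat_of_le_succ fun n => hnx1 (q n)
  have hU : ((⨆ n, (q n).1 : Submodule ℝ E) : Set E) = ⋃ n, ((q n).1 : Set E) :=
    Submodule.coe_iSup_of_directed _ hmono.directed_le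
  refine ⟨(⨆ n, (q n).1).topologicalClosure, Submodule.isClosed_topologicalClosure _, ?_, ?_, ?_⟩
  · rw [Submodule.topologicalClosure_coe, hU]
    exact (TopologicalSpace.IsSeparable.iUnion fun n => (q n).2).closure
  · apply Submodule.le_topologicalClosure
    exact (le_iSup (fun n => (q n).1) 0) (Submodule.mem_span_singleton_self a)
  · have := bp_approx_closure (w := w) hσ hp hm (⋃ n, ((q n).1 : Set E))
        {i | w i ∈ (⨆ n, (q n).1).topologicalClosure} (by
          intro η hη δ hδ
          obtain ⟨n, hn⟩ := mem_iUnion.mp hη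
          obtain ⟨i, hi1, hi2⟩ := hnx2 (q n) η hn δ hδ
          exact ⟨i, Submodule.le_topologicalClosure _ (le_iSup (fun n => (q n).1) (n+1) hi1), hi2⟩)
    intro η hη
    apply this
    rw [← hU]
    exact hη

end

theorem bp_kadec {X : Type*} [NormedAddCommGroup X] [NormedSpace ℝ X]
    (hKadec : IsInducing (fun x : Metric.sphere (0:X) 1 => fun l : X →L[ℝ] ℝ => l (x : X)))
    {J : Type*} (U : Filter J) (z : J → X) (y : X)
    (hw : ∀ l : X →L[ℝ] ℝ, Tendsto (fun j => l (z j)) U (𝓝 (l y)))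
    (hn : Tendsto (fun j => ‖z j‖) U (𝓝 ‖y‖)) : Tendsto z U (𝓝 y) := by
  classical
  rcases eq_or_ne y 0 with rfl | hy
  · rw [norm_zero] at hn
    exact tendsto_zero_iff_norm_tendsto_zero.mpr hn
  have hy0 : ‖y‖ ≠ 0 := norm_ne_zero_iff.mpr hy
  have hs : ∀ x : X, x ≠ 0 → ‖x‖⁻¹ • x ∈ sphere (0:X) 1 := fun x hx => by
    have : ‖x‖ ≠ 0 := norm_ne_zero_iff.mpr hx
    rw [mem_sphere_zero_iff_norm, norm_smul, norm_inv, norm_norm, inv_mul_cancel₀ this]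
  let N : X → sphere (0:X) 1 := fun x =>
    if hx : x = 0 then ⟨‖y‖⁻¹ • y, hs y hy⟩ else ⟨‖x‖⁻¹ • x, hs x hx⟩
  have hN : ∀ x, x ≠ 0 → (N x : X) = ‖x‖⁻¹ • x := fun x hx => by simp [N, hx]
  have hne : ∀ᶠ j in U, z j ≠ 0 := by
    filter_upwards [hn.eventually_ne hy0] with j hj
    exact norm_ne_zero_iff.mp hj
  have hNt : Tendsto (fun j => N (z j)) U (𝓝 (N y)) := by
    rw [hKadec.tendsto_nhds_iff, tendsto_pi_nhds]
    intro l
    have h1 : Tendsto (fun j => ‖z j‖⁻¹ * l (z j)) U (𝓝 (‖y‖⁻¹ * l y)) := (hn.inv₀ hy0).mul (hw l)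
    simp only [Function.comp, hN y hy, map_smul, smul_eq_mul]
    refine h1.congr' ?_
    filter_upwards [hne] with j hj
    rw [hN _ hj, map_smul, smul_eq_mul]
  have h2 : Tendsto (fun j => ‖z j‖ • (N (z j) : X)) U (𝓝 (‖y‖ • (N y : X))) :=
    hn.smul ((continuous_subtype_val.tendsto _).comp hNt)
  have h3 : ∀ x, x ≠ 0 → ‖x‖ • (N x : X) = x := fun x hx => by
    rw [hN x hx, smul_smul, mul_inv_cancel₀ (norm_ne_zero_iff.mpr hx), one_smul]
  rw [h3 y hy] at h2
  refine h2.congr' ?_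
  filter_upwards [hne] with j hj
  exact h3 _ hj

theorem bp_core {X : Type*} [NormedAddCommGroup X] [NormedSpace ℝ X] [CompleteSpace X]
    (f : X → EReal)
    (hfbdd : ∃ c : ℝ, ∀ u, (c : EReal) ≤ f u)
    (hflsc : LowerSemicontinuous f)
    (hRefl : Function.Surjective ⇑(NormedSpace.inclusionInDoubleDual ℝ X))
    (hKadec : IsInducing (fun x : Metric.sphere (0:X) 1 => fun l : X →L[ℝ] ℝ => l (x : X)))
    (a : X) (ρ σ p : ℝ) (hρ : 0 < ρ) (hσ : 0 < σ) (hp : 1 ≤ p)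
    (hstart : f a < (⨅ w, f w) + ((σ * ρ ^ p : ℝ) : EReal)) :
    ∃ v η : X, ‖v - a‖ < ρ ∧ ‖η - a‖ ≤ ρ ∧
      f v < (⨅ w, f w) + ((σ * ρ ^ p : ℝ) : EReal) ∧
      ∀ w : X, f v + ((σ * (‖v - η‖ ^ p - ‖w - η‖ ^ p) : ℝ) : EReal) ≤ f w := by
  obtain ⟨c, hc⟩ := hfbdd
  have hbot : ∀ x, f x ≠ ⊥ := fun x h => by
    have := hc x; rw [h] at this; simp at this
  have hfa : f a ≠ ⊤ := fun h => by rw [h] at hstart; exact not_top_lt hstart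
  have hreal : ∀ x, f x ≠ ⊤ → ((f x).toReal : EReal) = f x := fun x hx =>
    EReal.coe_toReal hx (hbot x)
  obtain ⟨b, hb⟩ : ∃ b : ℝ, (b : EReal) = ⨅ w, f w := by
    refine ⟨(⨅ w, f w).toReal, EReal.coe_toReal ?_ ?_⟩
    · exact ne_top_of_le_ne_top hfa (iInf_le _ a)
    · intro h
      have : (c : EReal) ≤ ⨅ w, f w := le_iInf hc
      rw [h] at this; simp at this
  rw [← hb] at hstart ⊢
  have hbf : ∀ x, f x ≠ ⊤ → b ≤ (f x).toReal := fun x hx => by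
    have : (b : EReal) ≤ f x := by rw [hb]; exact iInf_le _ x
    rw [← hreal x hx] at this
    exact_mod_cast this
  have hstart' : (f a).toReal < b + σ * ρ ^ p := by
    rw [← hreal a hfa] at hstart
    exact_mod_cast hstart
  -- choice of the radius
  obtain ⟨r, hr0, hrρ, hr⟩ : ∃ r, 0 < r ∧ r < ρ ∧ (f a).toReal + σ * r ^ p < b + σ * (ρ - r) ^ p := by
    have hp0 : (0:ℝ) ≤ p := by linarith
    have hcont : Continuous (fun r : ℝ => b + σ * (ρ - r) ^ p - ((f a).toReal + σ * r ^ p)) := by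
      have h1 : Continuous (fun r : ℝ => r ^ p) := Real.continuous_rpow_const hp0
      have h2 : Continuous (fun r : ℝ => (ρ - r) ^ p) := h1.comp (by fun_prop)
      fun_prop
    have h0 : 0 < (fun r : ℝ => b + σ * (ρ - r) ^ p - ((f a).toReal + σ * r ^ p)) 0 := by
      have : (0:ℝ) ^ p = 0 := Real.zero_rpow (by linarith)
      simp only [sub_zero, this]; linarith
    have h1 := (hcont.tendsto 0).eventually (lt_mem_nhds h0)
    have h2 : ∀ᶠ r in 𝓝[>] (0:ℝ), r < ρ := (gt_mem_nhds hρ).filter_mono nhdsWithin_le_nhds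
    obtain ⟨r, ⟨hr1, hr2⟩, hr3⟩ :=
      (((h1.filter_mono nhdsWithin_le_nhds).and h2).and self_mem_nhdsWithin).exists
    exact ⟨r, hr3, hr2, by linarith⟩
  let I := {x : X // f x ≠ ⊤}
  have : Nonempty I := ⟨⟨a, hfa⟩⟩
  let φ : I → ℝ := fun i => (f i.1).toReal
  let w : I → X := fun i => i.1
  have hm : ∀ i, b ≤ φ i := fun i => hbf _ i.2
  obtain ⟨Y, hYc, hYs, haY, hYr⟩ := bp_rich (w := w) hσ hp hm a
  have : TopologicalSpace.SeparableSpace Y := hYs.separableSpace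
  have : TopologicalSpace.SeparableSpace (Y →L[ℝ] ℝ) := bp_sep_dual hRefl Y hYc
  have : CompleteSpace Y := hYc.completeSpace_coe
  let J := {y : Y // f (y : X) ≠ ⊤}
  have : Nonempty J := ⟨⟨⟨a, haY⟩, hfa⟩⟩
  let φ' : J → ℝ := fun j => (f (j.1 : X)).toReal
  let w' : J → Y := fun j => j.1
  have hm' : ∀ j, b ≤ φ' j := fun j => hbf _ j.2
  obtain ⟨η, hηa, hη⟩ := bpO_dense (w := w') hσ hp hm' ⟨a, haY⟩ r hr0
  have hηa' : ‖(η : X) - a‖ < r := hηa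
  have hFF : ∀ j : J, bpF φ' w' σ p η j = (f (j.1 : X)).toReal + σ * ‖((j.1 : Y) : X) - η‖ ^ p :=
    fun j => rfl
  set g := bpG φ' w' σ p η with hg
  -- global infimum
  have hgX : ∀ x, f x ≠ ⊤ → g ≤ (f x).toReal + σ * ‖x - η‖ ^ p := by
    intro x hx
    have h1 : g ≤ bpG φ w σ p (η : X) := by
      refine le_of_forall_pos_lt_add fun δ hδ => ?_
      obtain ⟨i, hi1, hi2⟩ := hYr η η.2 δ hδ
      refine lt_of_le_of_lt ?_ hi2
      exact bpG_le hσ hm' η (⟨⟨i.1, hi1⟩, i.2⟩ : J)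
    exact h1.trans (bpG_le hσ hm (η : X) (⟨x, hx⟩ : I))
  -- minimizing sequence
  have hseq : ∀ n : ℕ, ∃ j, bpF φ' w' σ p η j < g + 1 / ((n:ℝ)+1) := fun n =>
    bpG_lt η _ (by positivity)
  choose j hj using hseq
  let x : ℕ → X := fun n => ((j n).1 : X)
  have hxt : ∀ n, f (x n) ≠ ⊤ := fun n => (j n).2
  have hFx : ∀ n, bpF φ' w' σ p η (j n) = (f (x n)).toReal + σ * ‖x n - η‖ ^ p := fun n => rfl
  have hFlim : Tendsto (fun n => bpF φ' w' σ p η (j n)) atTop (𝓝 g) := by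
    have h1 : Tendsto (fun n : ℕ => g + 1 / ((n:ℝ)+1)) atTop (𝓝 (g + 0)) :=
      tendsto_const_nhds.add tendsto_one_div_add_atTop_nhds_zero_nat
    rw [add_zero] at h1
    exact tendsto_of_tendsto_of_tendsto_of_le_of_le tendsto_const_nhds h1
      (fun n => bpG_le hσ hm' η (j n)) (fun n => (hj n).le)
  obtain ⟨R, hR0, hR⟩ := bp_pow_bound p hp σ hσ b (g + 1)
  have hxR : ∀ n, ‖x n - η‖ ≤ R := by
    intro n
    refine hR _ (norm_nonneg _) ?_
    have h1 := hj n
    rw [hFx] at h1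
    have h2 := hbf _ (hxt n)
    have h3 : 1 / ((n:ℝ)+1) ≤ 1 := by
      rw [div_le_one (by positivity)]; linarith [(Nat.cast_nonneg n : (0:ℝ) ≤ n)]
    linarith
  let U : Ultrafilter ℕ := Ultrafilter.of atTop
  have hU : (U : Filter ℕ) ≤ atTop := Ultrafilter.of_le _
  have hiso : ∀ y : X, ‖NormedSpace.inclusionInDoubleDual ℝ X y‖ = ‖y‖ := fun y =>
    (NormedSpace.inclusionInDoubleDualLi ℝ (E := X)).norm_map y
  obtain ⟨Z, _, hZ⟩ := bp_weakstar U
    (fun n => NormedSpace.inclusionInDoubleDual ℝ X (x n - η)) R (fun n => by rw [hiso]; exact hxR n)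
  obtain ⟨z, rfl⟩ := hRefl Z
  obtain ⟨d, hd, hdt⟩ := bp_ultra_real U (fun n => ‖x n - η‖) 0 R
    (fun n => ⟨norm_nonneg _, hxR n⟩)
  have hzd : ‖z‖ ≤ d := by
    rw [← hiso]
    exact bp_norm_le U _ _ hZ d (by simpa only [hiso] using hdt)
  have hw : ∀ l : X →L[ℝ] ℝ, Tendsto (fun n => l (x n - η)) U (𝓝 (l z)) := fun l => hZ l
  have hdz : d ≤ ‖z‖ := by
    refine le_of_forall_pos_le_add fun ε hε => ?_
    obtain ⟨l, hl1, δ, hδ, hl⟩ := hη ε hε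
    obtain ⟨l', hl', hl'n⟩ := exists_extension_norm_eq Y l
    have h1 : ∀ᶠ n in (U : Filter ℕ), ‖x n - η‖ - ε ≤ l' (x n - η) := by
      have h2 := (hFlim.mono_left hU).eventually (gt_mem_nhds (show g < g + δ by linarith))
      filter_upwards [h2] with n hn
      have h3 := hl (j n) hn.le
      rw [← hl'] at h3
      exact h3
    have h4 : d - ε ≤ l' z := le_of_tendsto_of_tendsto (hdt.sub_const ε) (hw l') h1
    have h5 := l'.le_of_opNorm_le (hl'n.trans_le hl1) z
    rw [one_mul] at h5
    have h6 := (le_abs_self _).trans h5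
    linarith
  have hd' : d = ‖z‖ := le_antisymm hdz hzd
  rw [hd'] at hdt
  have hstrong := bp_kadec hKadec (U : Filter ℕ) (fun n => x n - η) z hw hdt
  have hxv : Tendsto x U (𝓝 (z + η)) := by
    simpa using hstrong.add_const (η : X)
  have hflim : Tendsto (fun n => (f (x n)).toReal) U (𝓝 (g - σ * ‖z‖ ^ p)) := by
    have h1 : Tendsto (fun n => ‖x n - η‖ ^ p) U (𝓝 (‖z‖ ^ p)) :=
      hdt.rpow_const (Or.inr (by linarith))
    have h2 := (hFlim.mono_left hU).sub (h1.const_mul σ)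
    refine h2.congr fun n => ?_
    rw [hFx]; ring
  have hfv : f (z + η) ≤ ((g - σ * ‖z‖ ^ p : ℝ) : EReal) := by
    by_contra hcon
    push Not at hcon
    obtain ⟨t, ht1, ht2⟩ := EReal.lt_iff_exists_real_btwn.mp hcon
    have h1 : ∀ᶠ n in (U : Filter ℕ), t ≤ (f (x n)).toReal := by
      filter_upwards [hxv.eventually (hflsc _ _ ht2)] with n hn
      rw [← hreal _ (hxt n)] at hn
      exact_mod_cast hn.le
    have h2 : t ≤ g - σ * ‖z‖ ^ p := ge_of_tendsto hflim h1
    have h3 : g - σ * ‖z‖ ^ p < t := by exact_mod_cast ht1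
    linarith
  have hvt : f (z + η) ≠ ⊤ := ne_top_of_le_ne_top (EReal.coe_ne_top _) hfv
  have hfv' : (f (z + η)).toReal ≤ g - σ * ‖z‖ ^ p := by
    rw [← hreal _ hvt] at hfv
    exact_mod_cast hfv
  have hga := hgX a hfa
  have har : ‖a - η‖ ^ p ≤ r ^ p := by
    rw [norm_sub_rev]
    exact Real.rpow_le_rpow (norm_nonneg _) hηa'.le (by linarith)
  have hga' : g ≤ (f a).toReal + σ * r ^ p := hga.trans (by gcongr)
  have hzz : 0 ≤ σ * ‖z‖ ^ p := by positivity
  have hzρ : ‖z‖ < ρ - r := by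
    have h1 := hbf _ hvt
    have h2 : σ * ‖z‖ ^ p < σ * (ρ - r) ^ p := by linarith
    have h3 := lt_of_mul_lt_mul_left h2 hσ.le
    exact (Real.rpow_lt_rpow_iff (norm_nonneg _) (by linarith) (by linarith)).mp h3
  refine ⟨z + η, η, ?_, by linarith, ?_, ?_⟩
  · have h1 : z + (η : X) - a = z + (η - a) := by abel
    rw [h1]
    exact (norm_add_le _ _).trans_lt (by linarith)
  · rw [← hreal _ hvt]
    have h1 : (ρ - r) ^ p ≤ ρ ^ p := Real.rpow_le_rpow (by linarith) (by linarith) (by linarith)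
    have h2 : σ * (ρ - r) ^ p ≤ σ * ρ ^ p := by gcongr
    have : (f (z + η)).toReal < b + σ * ρ ^ p := by linarith
    exact_mod_cast this
  · intro y
    by_cases hy : f y = ⊤
    · rw [hy]; exact le_top
    rw [← hreal _ hvt, ← hreal _ hy, add_sub_cancel_right]
    have h1 := hgX y hy
    have : (f (z + η)).toReal + σ * (‖z‖ ^ p - ‖y - η‖ ^ p) ≤ (f y).toReal := by
      rw [mul_sub]; linarith
    exact_mod_cast this


theorem symmetric_borwein_preiss
    {X : Type*} [NormedAddCommGroup X] [NormedSpace ℝ X] [CompleteSpace X]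
    {V : Type*} [NormedAddCommGroup V] [NormedSpace ℝ V] [CompleteSpace V]
    {W : Type*} [NormedAddCommGroup W] [NormedSpace ℝ W] [CompleteSpace W]
    (ι : X →L[ℝ] V) (κ : V →L[ℝ] W)
    (K : ℝ) (hK : 0 < K) (hιK : ∀ u : X, ‖ι u‖ ≤ K * ‖u‖)
    (S : Set X)
    {P : Type*} [TopologicalSpace P] [PathConnectedSpace P]
    (pol : X → P → X) (sy : X → X)
    (hpolS : ∀ u ∈ S, ∀ H : P, pol u H ∈ S)
    (hsyS : ∀ u : X, sy u ∈ S)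
    (hpolCont : ContinuousOn (fun q : X × P => pol q.1 q.2) (S ×ˢ Set.univ))
    (hsypol : ∀ u ∈ S, ∀ H : P,
      pol (sy u) H = sy u ∧ sy (pol u H) = sy u ∧ pol (pol u H) H = pol u H)
    (happrox : ∃ Hs : ℕ → P, ∀ u ∈ S,
      Filter.Tendsto (fun m => ι (List.foldl pol u ((List.range m).map Hs)))
        Filter.atTop (nhds (ι (sy u))))
    (hpolContr : ∀ u ∈ S, ∀ v ∈ S, ∀ H : P, ‖ι (pol u H) - ι (pol v H)‖ ≤ ‖ι u - ι v‖)
    (Θ : X → X) (CΘ : ℝ) (hCΘ : 0 < CΘ)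
    (hΘS : ∀ u : X, Θ u ∈ S) (hΘid : ∀ u ∈ S, Θ u = u)
    (hΘlip : ∀ u v : X, ‖ι (Θ u) - ι (Θ v)‖ ≤ CΘ * ‖ι u - ι v‖)
    (hpolext : ∀ u : X, ∀ H : P, pol u H = pol (Θ u) H)
    (hsyext : ∀ u : X, sy u = sy (Θ u))
    (T : ℝ → X → X)
    (hTS : ∀ ρ > (0:ℝ), ∀ u ∈ S, T ρ u ∈ S)
    (hTpol : ∀ ρ > (0:ℝ), ∀ u ∈ S, ∃ l : List P, T ρ u = List.foldl pol u l)
    (hTsy : ∀ ρ > (0:ℝ), ∀ u ∈ S, sy (T ρ u) = sy u)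
    (hTapprox : ∀ ρ > (0:ℝ), ∀ u ∈ S, ‖ι (T ρ u) - ι (sy u)‖ < ρ)
    (f : X → EReal)
    (hfproper : ∃ u, f u ≠ ⊤)
    (hfbdd : ∃ c : ℝ, ∀ u, (c : EReal) ≤ f u)
    (hflsc : LowerSemicontinuous f)
    (hfpol : ∀ u ∈ S, ∀ H : P, f (pol u H) ≤ f u)
    (hRefl : Function.Surjective ⇑(NormedSpace.inclusionInDoubleDual ℝ X))
    (hKadec : IsInducing (fun x : Metric.sphere (0:X) 1 => fun l : X →L[ℝ] ℝ => l (x : X)))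
    (u : X) (hu : u ∈ S) (ρ σ p : ℝ) (hρ : 0 < ρ) (hσ : 0 < σ) (hp : 1 ≤ p)
    (hstart : f u < (⨅ w, f w) + ((σ * ρ ^ p : ℝ) : EReal)) :
    ∃ v η : X,
      ‖ι v - ι (sy v)‖ < (K * (CΘ + 1) + 1) * ρ ∧
      ‖v - u‖ < ρ + ‖T ρ u - u‖ ∧
      ‖η - u‖ ≤ ρ + ‖T ρ u - u‖ ∧
      f v < (⨅ w, f w) + ((σ * ρ ^ p : ℝ) : EReal) ∧
      ∀ w : X, f v + ((σ * (‖v - η‖ ^ p - ‖w - η‖ ^ p) : ℝ) : EReal) ≤ f w := by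
  have hfoldS : ∀ (l : List P) (x : X), x ∈ S → List.foldl pol x l ∈ S ∧
      f (List.foldl pol x l) ≤ f x := by
    intro l
    induction l with
    | nil => intro x hx; exact ⟨hx, le_rfl⟩
    | cons H l ih =>
      intro x hx
      obtain ⟨h1, h2⟩ := ih (pol x H) (hpolS x hx H)
      exact ⟨h1, h2.trans (hfpol x hx H)⟩
  have hfoldC : ∀ (l : List P) (x y : X), x ∈ S → y ∈ S →
      ‖ι (List.foldl pol x l) - ι (List.foldl pol y l)‖ ≤ ‖ι x - ι y‖ := by
    intro l
    induction l with
    | nil => intro x y _ _; exact le_rfl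
    | cons H l ih =>
      intro x y hx hy
      exact (ih (pol x H) (pol y H) (hpolS x hx H) (hpolS y hy H)).trans (hpolContr x hx y hy H)
  have hsyL : ∀ x y : X, ‖ι (sy x) - ι (sy y)‖ ≤ CΘ * ‖ι x - ι y‖ := by
    intro x y
    obtain ⟨Hs, hHs⟩ := happrox
    have hlim := ((hHs (Θ x) (hΘS x)).sub (hHs (Θ y) (hΘS y))).norm
    have h1 : ‖ι (sy (Θ x)) - ι (sy (Θ y))‖ ≤ ‖ι (Θ x) - ι (Θ y)‖ :=
      le_of_tendsto hlim (Filter.Eventually.of_forall fun m =>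
        hfoldC _ (Θ x) (Θ y) (hΘS x) (hΘS y))
    rw [hsyext x, hsyext y]
    exact h1.trans (hΘlip x y)
  have hTle : f (T ρ u) ≤ f u := by
    obtain ⟨l, hl⟩ := hTpol ρ hρ u hu
    rw [hl]
    exact (hfoldS l u hu).2
  obtain ⟨v, η, hv, hη, hfv, hmin⟩ :=
    bp_core f hfbdd hflsc hRefl hKadec (T ρ u) ρ σ p hρ hσ hp (lt_of_le_of_lt hTle hstart)
  refine ⟨v, η, ?_, ?_, ?_, hfv, hmin⟩
  · have e1 : ‖ι v - ι (T ρ u)‖ ≤ K * ρ := by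
      rw [← map_sub]
      exact (hιK _).trans (mul_le_mul_of_nonneg_left hv.le hK.le)
    have e2 := hTapprox ρ hρ u hu
    have e3 := hsyL (T ρ u) v
    rw [hTsy ρ hρ u hu, norm_sub_rev (ι (T ρ u))] at e3
    have e4 : CΘ * ‖ι v - ι (T ρ u)‖ ≤ CΘ * (K * ρ) := mul_le_mul_of_nonneg_left e1 hCΘ.le
    have e5 : ι v - ι (sy v) =
        (ι v - ι (T ρ u)) + (ι (T ρ u) - ι (sy u)) + (ι (sy u) - ι (sy v)) := by abel
    have e6 := norm_add₃_le (a := ι v - ι (T ρ u)) (b := ι (T ρ u) - ι (sy u))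
      (c := ι (sy u) - ι (sy v))
    rw [e5]
    nlinarith
  · have := norm_sub_le_norm_sub_add_norm_sub v (T ρ u) u
    linarith
  · have := norm_sub_le_norm_sub_add_norm_sub η (T ρ u) u
    linarith
end

section
/- Symmetric Deville–Godefroy–Zizler principle. In the abstract symmetrization framework, let X be a Banach space, β a bornology of bounded subsets of X, and suppose X admits a bump function in X_β. Let f : X → ℝ ∪ {+∞} be a proper, bounded below, lower semicontinuous functional such that f(u^H) ≤ f(u) for all u ∈ S and all H ∈ ℋ*. Then there exists a constant 𝒜 > 0 such that for every ε ∈ (0,1) and every u ∈ S with f(u) < inf_X f + 𝒜ε², there exist g ∈ X_β and v ∈ X such that: (a) ‖v − v*‖_V < (K(C_Θ+1)+1)ε; (b) ‖v − u‖ ≤ ε + ‖T_ε u − u‖; (c) ‖g‖_∞ ≤ ε and ‖g'‖_∞ ≤ ε; (d) f(w) + g(w) ≥ f(v) + g(v) for all w ∈ X. -/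
open Filter Topology Metric Set

/-- `β`-differentiability of `g` with derivative `g'`. -/
def BD {X : Type*} [NormedAddCommGroup X] [NormedSpace ℝ X] (β : Set (Set X))
    (g : X → ℝ) (g' : X → X →L[ℝ] ℝ) : Prop :=
  ∀ z : X, ∀ B ∈ β, ∀ ε > (0:ℝ), ∃ δ > (0:ℝ), ∀ t : ℝ, t ≠ 0 → |t| < δ →
        ∀ w ∈ B, |g (z + t • w) - g z - t * (g' z) w| ≤ ε * |t|

section helpers
variable {X : Type*} [NormedAddCommGroup X] [NormedSpace ℝ X] {β : Set (Set X)}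

lemma BD.add {g h : X → ℝ} {g' h' : X → X →L[ℝ] ℝ} (hg : BD β g g') (hh : BD β h h') :
    BD β (fun x => g x + h x) (fun x => g' x + h' x) := by
  intro z B hB ε hε
  obtain ⟨d1, hd1, H1⟩ := hg z B hB (ε/2) (by positivity)
  obtain ⟨d2, hd2, H2⟩ := hh z B hB (ε/2) (by positivity)
  refine ⟨min d1 d2, lt_min hd1 hd2, fun t ht htd w hw => ?_⟩
  have h1 := abs_le.1 (H1 t ht (lt_of_lt_of_le htd (min_le_left _ _)) w hw)
  have h2 := abs_le.1 (H2 t ht (lt_of_lt_of_le htd (min_le_right _ _)) w hw)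
  simp only [ContinuousLinearMap.add_apply]
  rw [abs_le]
  constructor <;> nlinarith [h1.1, h1.2, h2.1, h2.2]

lemma BD.zero : BD β (fun _ => 0) (fun _ => 0) := by
  intro z B hB ε hε
  refine ⟨1, one_pos, fun t ht htd w hw => ?_⟩
  simp only [ContinuousLinearMap.zero_apply]
  simp
  positivity

lemma BD.sum {g : ℕ → X → ℝ} {g' : ℕ → X → X →L[ℝ] ℝ} (hg : ∀ n, BD β (g n) (g' n)) (N : ℕ) :
    BD β (fun x => ∑ n ∈ Finset.range N, g n x) (fun x => ∑ n ∈ Finset.range N, g' n x) := by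
  induction N with
  | zero => simpa using BD.zero
  | succ k ih =>
    simp only [Finset.sum_range_succ]
    exact ih.add (hg k)

lemma BD.comp {b : X → ℝ} {b' : X → X →L[ℝ] ℝ} (hb : BD β b b') (k s : ℝ) (hs : 0 < s)
    (z0 v : X) :
    BD β (fun x => k * b (z0 + s • (x - v))) (fun x => (k * s) • b' (z0 + s • (x - v))) := by
  intro z B hB ε hε
  obtain ⟨d, hd, H⟩ := hb (z0 + s • (z - v)) B hB (ε/((|k|+1)*s)) (by positivity)
  refine ⟨d/s, by positivity, fun t ht htd w hw => ?_⟩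
  have h1 := H (s*t) (by positivity) (by
    rw [abs_mul, abs_of_pos hs]; rw [lt_div_iff₀ hs] at htd; linarith) w hw
  have e1 : z0 + s • (z + t • w - v) = z0 + s • (z - v) + (s*t) • w := by
    module
  beta_reduce
  rw [e1]
  simp only [ContinuousLinearMap.smul_apply, smul_eq_mul]
  have e2 : k * b (z0 + s • (z - v) + (s*t) • w) - k * b (z0 + s • (z - v)) -
      t * (k * s * b' (z0 + s • (z - v)) w) = k * (b (z0 + s • (z - v) + (s*t) • w) -
       b (z0 + s • (z - v)) - s * t * b' (z0 + s • (z - v)) w) := by ring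
  rw [e2, abs_mul]
  calc _ ≤ (|k|+1) * (ε/((|k|+1)*s) * |s*t|) := by
        apply mul_le_mul _ h1 (abs_nonneg _) (by positivity)
        linarith
    _ = ε * |t| := by
        rw [abs_mul, abs_of_pos hs]; field_simp

lemma BD.norm_le {g : X → ℝ} {g' : X → X →L[ℝ] ℝ} (hg : BD β g g')
    (hcover : ∀ x : X, ∃ B ∈ β, x ∈ B) {L : ℝ} (hL : 0 ≤ L)
    (hlip : ∀ x y, |g x - g y| ≤ L * ‖x - y‖) (z : X) : ‖g' z‖ ≤ L := by
  refine ContinuousLinearMap.opNorm_le_bound _ hL fun w => ?_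
  obtain ⟨B, hB, hw⟩ := hcover w
  refine le_of_forall_pos_le_add fun ε hε => ?_
  obtain ⟨d, hd, H⟩ := hg z B hB ε hε
  have ht : (0:ℝ) < d/2 := by positivity
  have h1 := H (d/2) ht.ne' (by rw [abs_of_pos ht]; linarith) w hw
  have h2 := hlip (z + (d/2) • w) z
  have e : ‖z + (d/2) • w - z‖ = (d/2) * ‖w‖ := by
    rw [add_sub_cancel_left, norm_smul, Real.norm_of_nonneg ht.le]
  rw [e] at h2
  rw [abs_of_pos ht] at h1
  rw [Real.norm_eq_abs]
  have h3 : (d/2) * |g' z w| ≤ (d/2) * (L * ‖w‖ + ε) := by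
    rw [← abs_of_pos ht, ← abs_mul, abs_of_pos ht]
    rw [abs_le] at *
    constructor <;> nlinarith [h1.1, h1.2, h2.1, h2.2]
  exact le_of_mul_le_mul_left h3 ht

lemma BD.limit {g : X → ℝ} {g' : X → X →L[ℝ] ℝ} (hbdd : ∀ B ∈ β, Bornology.IsBounded B)
    (H : ∀ η > (0:ℝ), ∃ (h : X → ℝ) (h' : X → X →L[ℝ] ℝ), BD β h h' ∧
      (∀ x y, |(g x - h x) - (g y - h y)| ≤ η * ‖x - y‖) ∧ ∀ z, ‖g' z - h' z‖ ≤ η) :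
    BD β g g' := by
  intro z B hB ε hε
  obtain ⟨C, hC0, hC⟩ := (hbdd B hB).exists_pos_norm_le
  obtain ⟨h, h', hh, h1, h2⟩ := H (ε/(4*C)) (by positivity)
  obtain ⟨d, hd, H⟩ := hh z B hB (ε/2) (by positivity)
  refine ⟨d, hd, fun t ht htd w hw => ?_⟩
  have a1 := H t ht htd w hw
  have a2 : |(g (z + t • w) - h (z + t • w)) - (g z - h z)| ≤ ε/4 * |t| := by
    refine (h1 _ _).trans ?_
    rw [add_sub_cancel_left, norm_smul, Real.norm_eq_abs]
    calc ε/(4*C) * (|t| * ‖w‖) ≤ ε/(4*C) * (|t| * C) := by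
          gcongr; exact hC w hw
      _ = _ := by field_simp
  have a3 : |t * (g' z - h' z) w| ≤ ε/4 * |t| := by
    rw [abs_mul]
    have := (g' z - h' z).le_opNorm w
    rw [Real.norm_eq_abs] at this
    calc |t| * |(g' z - h' z) w| ≤ |t| * (ε/(4*C) * C) := by
          gcongr
          refine this.trans ?_
          gcongr
          · exact h2 z
          · exact hC w hw
      _ = _ := by field_simp
  rw [ContinuousLinearMap.sub_apply] at a3
  rw [abs_le] at *
  constructor <;> nlinarith [a1.1, a1.2, a2.1, a2.2, a3.1, a3.2]

lemma hs_geo (a : ℝ) : HasSum (fun n : ℕ => a * (1/2)^n) (2*a) := by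
  have := hasSum_geometric_two.mul_left a
  rwa [mul_comm a 2] at this

lemma hs_geo' (a : ℝ) (N : ℕ) :
    HasSum (fun n : ℕ => a * (1/2)^(n+N)) (2*a*(1/2)^N) := by
  have := hs_geo (a*(1/2)^N)
  convert this using 1
  · funext n; ring
  · ring

lemma series_tail {g : ℕ → X → ℝ} {a l : ℝ} (ha : ∀ n x, |g n x| ≤ a * (1/2)^n)
    (hl : ∀ n x y, |g n x - g n y| ≤ l * (1/2)^n * ‖x - y‖) (N : ℕ) :
    (∀ x, |(∑' n, g n x) - ∑ n ∈ Finset.range N, g n x| ≤ 2*a*(1/2)^N) ∧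
    ∀ x y, |((∑' n, g n x) - ∑ n ∈ Finset.range N, g n x) -
      ((∑' n, g n y) - ∑ n ∈ Finset.range N, g n y)| ≤ 2*l*(1/2)^N * ‖x - y‖ := by
  have hs : ∀ x, Summable (fun n => g n x) := fun x =>
    Summable.of_norm_bounded (hs_geo a).summable (fun n => ha n x)
  have e : ∀ x, (∑' n, g n x) - ∑ n ∈ Finset.range N, g n x = ∑' n, g (n+N) x := fun x => by
    rw [← (hs x).sum_add_tsum_nat_add N]; ring
  have hs' : ∀ x, Summable (fun n => g (n+N) x) := fun x => (summable_nat_add_iff N).2 (hs x)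
  constructor
  · intro x
    rw [e, ← Real.norm_eq_abs]
    exact tsum_of_norm_bounded (hs_geo' a N) (fun n => ha (n+N) x)
  · intro x y
    rw [e, e, ← (hs' x).tsum_sub (hs' y), ← Real.norm_eq_abs]
    exact tsum_of_norm_bounded ((hs_geo' l N).mul_right ‖x-y‖) (fun n => hl (n+N) x y)

lemma series_BD (hbdd : ∀ B ∈ β, Bornology.IsBounded B)
    (hcover : ∀ x : X, ∃ B ∈ β, x ∈ B)
    {g : ℕ → X → ℝ} {g' : ℕ → X → X →L[ℝ] ℝ} {a l : ℝ} (hl0 : 0 ≤ l)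
    (ha : ∀ n x, |g n x| ≤ a * (1/2)^n)
    (hl : ∀ n x y, |g n x - g n y| ≤ l * (1/2)^n * ‖x - y‖)
    (hg : ∀ n, BD β (g n) (g' n)) :
    BD β (fun x => ∑' n, g n x) (fun x => ∑' n, g' n x) := by
  have hn : ∀ n z, ‖g' n z‖ ≤ l * (1/2)^n := fun n z =>
    (hg n).norm_le hcover (by positivity) (hl n) z
  have hs : ∀ z, Summable (fun n => g' n z) := fun z =>
    Summable.of_norm_bounded (hs_geo l).summable (fun n => hn n z)
  apply BD.limit hbdd
  intro η hη
  obtain ⟨N, hN⟩ : ∃ N : ℕ, 2*l*(1/2:ℝ)^N ≤ η := by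
    have : Tendsto (fun N : ℕ => 2*l*(1/2:ℝ)^N) atTop (𝓝 (2*l*0)) :=
      (tendsto_pow_atTop_nhds_zero_of_lt_one (by norm_num) (by norm_num)).const_mul _
    rw [mul_zero] at this
    obtain ⟨N, hN⟩ := (this.eventually (gt_mem_nhds hη)).exists
    exact ⟨N, hN.le⟩
  refine ⟨_, _, BD.sum hg N, fun x y => ?_, fun z => ?_⟩
  · refine ((series_tail ha hl N).2 x y).trans ?_
    gcongr
  · have e : (∑' n, g' n z) - ∑ n ∈ Finset.range N, g' n z = ∑' n, g' (n+N) z := by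
      rw [← (hs z).sum_add_tsum_nat_add N]; abel
    rw [e]
    exact (tsum_of_norm_bounded (hs_geo' l N) (fun n => hn (n+N) z)).trans hN

lemma near_min (D : Set X) (F : X → ℝ) (hD : D.Nonempty) (m : ℝ) (hm : ∀ x ∈ D, m ≤ F x)
    (δ : ℝ) (hδ : 0 < δ) : ∃ x ∈ D, ∀ w ∈ D, F x ≤ F w + δ := by
  have hb : BddBelow (F '' D) := ⟨m, by rintro _ ⟨x, hx, rfl⟩; exact hm x hx⟩
  obtain ⟨_, ⟨x, hx, rfl⟩, h⟩ := exists_lt_of_csInf_lt (hD.image F)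
    (show sInf (F '' D) < sInf (F '' D) + δ by linarith)
  exact ⟨x, hx, fun w hw => by linarith [csInf_le hb (mem_image_of_mem F hw)]⟩

/-- Construction of the sequence. -/
lemma exists_seq (D : Set X) (F : X → ℝ) (m : ℝ) (hm : ∀ x ∈ D, m ≤ F x)
    (g : ℕ → X → X → ℝ) (q : ℕ → ℝ) (hq : ∀ n, 0 < q n) (a : ℕ → ℝ)
    (hg : ∀ n v x, |g n v x| ≤ a n)
    (v0 : X) (hv0 : v0 ∈ D) (h0 : ∀ w ∈ D, F v0 ≤ F w + q 0) :
    ∃ v : ℕ → X, v 0 = v0 ∧ ∀ n, v n ∈ D ∧ ∀ w ∈ D,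
      F (v n) + ∑ k ∈ Finset.range n, g k (v k) (v n) ≤
      F w + ∑ k ∈ Finset.range n, g k (v k) w + q n := by
  have hsel : ∀ (G : X → ℝ) (δ : ℝ), ∃ x, (∃ m', ∀ w, m' ≤ G w) → 0 < δ →
      x ∈ D ∧ ∀ w ∈ D, F x + G x ≤ F w + G w + δ := by
    intro G δ
    by_cases h : (∃ m', ∀ w, m' ≤ G w) ∧ 0 < δ
    · obtain ⟨⟨m', hm'⟩, hδ⟩ := h
      obtain ⟨x, hx, hx'⟩ := near_min D (fun x => F x + G x) ⟨v0, hv0⟩ (m + m')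
        (fun x hx => add_le_add (hm x hx) (hm' x)) δ hδ
      exact ⟨x, fun _ _ => ⟨hx, hx'⟩⟩
    · exact ⟨v0, fun h1 h2 => absurd ⟨h1, h2⟩ h⟩
  choose sel hsel using hsel
  obtain ⟨st, st0, stS⟩ : ∃ st : ℕ → X × (X → ℝ), st 0 = (v0, fun _ => 0) ∧ ∀ n, st (n+1) =
      (sel (fun x => (st n).2 x + g n (st n).1 x) (q (n+1)),
        fun x => (st n).2 x + g n (st n).1 x) :=
    ⟨fun n => Nat.rec (v0, fun _ => 0)
    (fun n p => (sel (fun x => p.2 x + g n p.1 x) (q (n+1)), fun x => p.2 x + g n p.1 x)) n,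
      rfl, fun _ => rfl⟩
  have hst : ∀ n, (st n).2 = fun x => ∑ k ∈ Finset.range n, g k (st k).1 x := by
    intro n
    induction n with
    | zero => funext x; simp [st0]
    | succ n ih =>
      funext x
      rw [Finset.sum_range_succ, ← congrFun ih x, stS]
  refine ⟨fun n => (st n).1, by simp [st0], fun n => ?_⟩
  cases n with
  | zero => simpa [st0] using ⟨hv0, h0⟩
  | succ n =>
    have e : (st (n+1)).1 = sel (st (n+1)).2 (q (n+1)) := by rw [stS]
    have := hsel (st (n+1)).2 (q (n+1)) ?_ (hq _)
    · rw [← e] at this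
      rw [hst] at this
      exact this
    · refine ⟨-∑ k ∈ Finset.range (n+1), a k, fun w => ?_⟩
      rw [hst, ← Finset.sum_neg_distrib]
      exact Finset.sum_le_sum fun k _ => (abs_le.1 (hg k _ w)).1

lemma core [CompleteSpace X] (D : Set X) (F : X → ℝ) (m : ℝ) (hm : ∀ x ∈ D, m ≤ F x)
    (hlsc : ∀ (x : ℕ → X) (y : X) (c : ℝ), (∀ n, x n ∈ D) → Tendsto x atTop (𝓝 y) →
      (∀ᶠ n in atTop, F (x n) ≤ c) → y ∈ D ∧ F y ≤ c)
    (φ : X → ℝ) (M L R : ℝ) (hφ0 : φ 0 = 1) (hM : ∀ x, |φ x| ≤ M)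
    (hL : ∀ x y, |φ x - φ y| ≤ L * ‖x - y‖) (hR : ∀ x, R ≤ ‖x‖ → φ x = 0)
    (c r : ℝ) (hc : 0 < c) (hr : 0 < r)
    (v0 : X) (hv0 : v0 ∈ D) (h0 : ∀ w ∈ D, F v0 ≤ F w + c/2) :
    ∃ (v : ℕ → X) (y : X),
      (∀ n x, |(-(c*(1/4)^n)) * φ ((r⁻¹*2^n) • (x - v n))| ≤ c*M*(1/2)^n) ∧
      (∀ n x x', |(-(c*(1/4)^n)) * φ ((r⁻¹*2^n) • (x - v n)) -
        (-(c*(1/4)^n)) * φ ((r⁻¹*2^n) • (x' - v n))| ≤ c/r*L*(1/2)^n * ‖x - x'‖) ∧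
      y ∈ D ∧ ‖y - v0‖ ≤ 2*R*r ∧
      ∀ w ∈ D, F y + ∑' n, (-(c*(1/4)^n)) * φ ((r⁻¹*2^n) • (y - v n)) ≤
        F w + ∑' n, (-(c*(1/4)^n)) * φ ((r⁻¹*2^n) • (w - v n)) := by
  have hM0 : 0 ≤ M := (abs_nonneg _).trans (hM 0)
  set g : ℕ → X → X → ℝ := fun n v x => (-(c*(1/4)^n)) * φ ((r⁻¹*2^n) • (x - v)) with hg
  have hga : ∀ n v x, |g n v x| ≤ c*M*(1/2)^n := by
    intro n v x
    simp only [hg]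
    rw [abs_mul, abs_neg, abs_of_pos (by positivity)]
    calc c*(1/4)^n * |φ ((r⁻¹*2^n) • (x - v))| ≤ c*(1/2)^n * M := by
          gcongr
          · norm_num
          · exact hM _
      _ = _ := by ring
  have hgl : ∀ n v x x', |g n v x - g n v x'| ≤ c/r*L*(1/2)^n * ‖x - x'‖ := by
    intro n v x x'
    simp only [hg]
    rw [← mul_sub, abs_mul, abs_neg, abs_of_pos (by positivity)]
    have h1 := hL ((r⁻¹*2^n) • (x - v)) ((r⁻¹*2^n) • (x' - v))
    rw [← smul_sub, sub_sub_sub_cancel_right, norm_smul, Real.norm_of_nonneg (by positivity)] at h1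
    calc _ ≤ c*(1/4)^n * (L * (r⁻¹ * 2 ^ n * ‖x - x'‖)) := by gcongr
      _ = c/r*L*((1/4)^n*2^n) * ‖x - x'‖ := by field_simp
      _ = _ := by rw [← mul_pow]; norm_num
  obtain ⟨v, hv0', hv⟩ := exists_seq D F m hm g (fun n => c*(1/4)^n/2) (fun n => by positivity)
    (fun n => c*M*(1/2)^n) hga v0 hv0 (by simpa using h0)
  have hstep : ∀ n, dist (v n) (v (n+1)) ≤ (2*R*r)/2/2^n := by
    intro n
    by_contra hcon
    push Not at hcon
    have h1 := (hv (n+1)).2 (v n) (hv n).1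
    have h2 := (hv n).2 (v (n+1)) (hv (n+1)).1
    rw [Finset.sum_range_succ, Finset.sum_range_succ] at h1
    have e1 : g n (v n) (v n) = -(c*(1/4)^n) := by simp [hg, hφ0]
    have e2 : g n (v n) (v (n+1)) = 0 := by
      simp only [hg]
      rw [hR, mul_zero]
      rw [norm_smul, Real.norm_of_nonneg (by positivity), ← dist_eq_norm, dist_comm]
      have : R = (r⁻¹*2^n) * ((2*R*r)/2/2^n) := by field_simp
      rw [this]
      gcongr
    rw [e1, e2] at h1
    have : (0:ℝ) < c * (1/4)^n := by positivity
    simp only [pow_succ] at h1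
    linarith
  obtain ⟨y, hy⟩ := cauchySeq_tendsto_of_complete (cauchySeq_of_le_geometric_two hstep)
  have hdist : ‖y - v0‖ ≤ 2*R*r := by
    have := dist_le_of_le_geometric_two_of_tendsto₀ hstep hy
    rwa [hv0', dist_comm, dist_eq_norm] at this
  have key : ∀ w ∈ D, ∀ η > (0:ℝ), y ∈ D ∧
      F y ≤ F w + ∑' n, g n (v n) w - ∑' n, g n (v n) y + η := by
    intro w hw η hη
    apply hlsc v y _ (fun n => (hv n).1) hy
    have t1 := fun N => series_tail (g := fun n => g n (v n)) (a := c*M) (l := c/r*L)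
      (fun n => hga n (v n)) (fun n => hgl n (v n)) N
    have lim : Tendsto (fun n : ℕ => 4*(c*M)*(1/2:ℝ)^n + c*(1/2)^n +
        2*(c/r*L)*(1/2)^0*‖v n - y‖) atTop
        (𝓝 (4*(c*M)*0 + c*0 + 2*(c/r*L)*(1/2)^0*‖y - y‖)) := by
      have hp : Tendsto (fun n : ℕ => (1/2:ℝ)^n) atTop (𝓝 0) :=
        tendsto_pow_atTop_nhds_zero_of_lt_one (by norm_num) (by norm_num)
      exact ((hp.const_mul _).add (hp.const_mul _)).add
        (((hy.sub_const y).norm).const_mul _)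
    simp only [sub_self, norm_zero, mul_zero, add_zero] at lim
    filter_upwards [lim.eventually (gt_mem_nhds hη)] with n hn
    have h1 := (hv n).2 w hw
    have h2 := abs_le.1 ((t1 n).1 (v n))
    have h3 := abs_le.1 ((t1 n).1 w)
    have h4 := (t1 0).2 (v n) y
    simp only [Finset.range_zero, Finset.sum_empty, sub_zero] at h4
    have h4 := abs_le.1 h4
    have h5 : c*(1/4:ℝ)^n/2 ≤ c*(1/2)^n := by
      have : (1/4:ℝ)^n ≤ (1/2)^n := by gcongr; norm_num
      have h6 : (0:ℝ) < (1/4)^n := by positivity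
      nlinarith
    linarith [h2.1, h2.2, h3.1, h3.2, h4.1, h4.2]
  refine ⟨v, y, fun n => hga n (v n), fun n => hgl n (v n), (key v0 hv0 1 one_pos).1, hdist, ?_⟩
  intro w hw
  refine le_of_forall_pos_le_add fun η hη => ?_
  have := (key w hw η hη).2
  simp only [hg] at this
  linarith

/-- Localized Deville-Godefroy-Zizler. -/
lemma dgz [CompleteSpace X]
    (f : X → EReal)
    (hfbdd : ∃ c : ℝ, ∀ u, (c : EReal) ≤ f u)
    (hflsc : LowerSemicontinuous f)
    (hβbdd : ∀ B ∈ β, Bornology.IsBounded B)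
    (hβcover : ∀ x : X, ∃ B ∈ β, x ∈ B)
    (b : X → ℝ) (b' : X → X →L[ℝ] ℝ)
    (hbM : ∃ M : ℝ, ∀ z : X, |b z| ≤ M)
    (hbL : ∃ L : ℝ, 0 ≤ L ∧ ∀ z₁ z₂ : X, |b z₁ - b z₂| ≤ L * ‖z₁ - z₂‖)
    (hb : BD β b b')
    (hbn : (Function.support b).Nonempty) (hbb : Bornology.IsBounded (Function.support b)) :
    ∃ A : ℝ, 0 < A ∧ ∀ ε : ℝ, 0 < ε → ε < 1 → ∀ u,
      f u < (⨅ w, f w) + ((A * ε ^ 2 : ℝ) : EReal) →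
      ∃ (g : X → ℝ) (g' : X → X →L[ℝ] ℝ) (v : X),
        (∃ L : ℝ, 0 ≤ L ∧ ∀ z₁ z₂ : X, |g z₁ - g z₂| ≤ L * ‖z₁ - z₂‖) ∧
        BD β g g' ∧ ‖v - u‖ < ε ∧
        (∀ z : X, |g z| ≤ ε) ∧ (∀ z : X, ‖g' z‖ ≤ ε) ∧
        (∀ w : X, f v + ((g v : ℝ) : EReal) ≤ f w + ((g w : ℝ) : EReal)) := by
  obtain ⟨m, hm⟩ := hfbdd
  obtain ⟨M₀, hM₀⟩ := hbM
  obtain ⟨L₀, hL₀0, hL₀⟩ := hbL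
  obtain ⟨z0, hz0⟩ := hbn
  obtain ⟨R₀, hR₀0, hR₀⟩ := hbb.exists_pos_norm_le
  have hz0 : b z0 ≠ 0 := hz0
  have hz0' : 0 < |b z0| := abs_pos.2 hz0
  set k := (b z0)⁻¹ with hk
  set φ : X → ℝ := fun x => k * b (z0 + x) with hφ
  set M := |k| * M₀ + 1 with hMdef
  set L := |k| * L₀ + 1 with hLdef
  set R := R₀ + ‖z0‖ + 1 with hRdef
  have hM₀0 : 0 ≤ M₀ := (abs_nonneg _).trans (hM₀ 0)
  have hM1 : 1 ≤ M := by have : 0 ≤ |k| * M₀ := by positivity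
                         linarith
  have hL1 : 1 ≤ L := by have : 0 ≤ |k| * L₀ := by positivity
                         linarith
  have hR1 : 1 ≤ R := by linarith [norm_nonneg z0]
  have hφ0 : φ 0 = 1 := by simp [hφ, hk, hz0]
  have hφM : ∀ x, |φ x| ≤ M := fun x => by
    simp only [hφ, abs_mul]
    have : |k| * |b (z0 + x)| ≤ |k| * M₀ := by gcongr; exact hM₀ _
    linarith
  have hφL : ∀ x y, |φ x - φ y| ≤ L * ‖x - y‖ := fun x y => by
    simp only [hφ]
    rw [← mul_sub, abs_mul]
    have h1 := hL₀ (z0 + x) (z0 + y)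
    rw [add_sub_add_left_eq_sub] at h1
    calc |k| * |b (z0 + x) - b (z0+y)| ≤ |k| * (L₀ * ‖x - y‖) := by gcongr
      _ ≤ L * ‖x - y‖ := by rw [hLdef]; nlinarith [norm_nonneg (x - y)]
  have hφR : ∀ x, R ≤ ‖x‖ → φ x = 0 := fun x hx => by
    by_contra hne
    have h1 : z0 + x ∈ Function.support b := fun h0 => hne (by simp [hφ, h0])
    have h2 := hR₀ _ h1
    have h3 : ‖x‖ ≤ ‖z0 + x‖ + ‖z0‖ := by
      have := norm_sub_le (z0 + x) z0
      rwa [add_sub_cancel_left] at this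
    linarith
  have hML : 0 < M*L*R := by positivity
  refine ⟨1/(16*(M*L*R)), by positivity, fun ε hε hε1 u hu => ?_⟩
  set A := 1/(16*(M*L*R)) with hA
  have hApos : 0 < A := by positivity
  have hbot : ∀ x, f x ≠ ⊥ := fun x h => by
    have := hm x
    rw [h] at this
    exact absurd this (by simp)
  have huI : ∀ w, f u ≤ f w + ((A * ε^2 : ℝ) : EReal) := fun w =>
    hu.le.trans (add_le_add (iInf_le _ _) le_rfl)
  have hutop : f u ≠ ⊤ := ne_top_of_lt hu
  set F : X → ℝ := fun x => (f x).toReal with hF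
  set D : Set X := {x | f x ≠ ⊤} with hD
  have hcoe : ∀ x ∈ D, f x = ((F x : ℝ) : EReal) := fun x hx =>
    (EReal.coe_toReal hx (hbot x)).symm
  obtain ⟨v, y, hga, hgl, hyD, hyd, hmin⟩ := core D F m
    (fun x hx => by have := hm x; rw [hcoe x hx] at this; exact_mod_cast this)
    (by
      intro x y c hx hxy hev
      have hcl : IsClosed (f ⁻¹' Set.Iic (c : EReal)) := hflsc.isClosed_preimage _
      have : y ∈ f ⁻¹' Set.Iic (c : EReal) := by
        apply hcl.mem_of_tendsto hxy
        filter_upwards [hev] with n hn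
        simp only [Set.mem_preimage, Set.mem_Iic]
        rw [hcoe _ (hx n)]
        exact_mod_cast hn
      have this : f y ≤ (c : EReal) := this
      have hyD : y ∈ D := ne_top_of_le_ne_top (EReal.coe_ne_top c) this
      refine ⟨hyD, ?_⟩
      rw [hcoe y hyD] at this
      exact_mod_cast this)
    φ M L R hφ0 hφM hφL hφR (2*A*ε^2) (ε/(4*R)) (by positivity) (by positivity) u hutop
    (by
      intro w hw
      have := huI w
      rw [hcoe u hutop, hcoe w hw] at this
      have h2 : F u ≤ F w + A * ε^2 := by exact_mod_cast this
      linarith)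
  have hLip := (series_tail hga hgl 0).2
  have hSup := (series_tail hga hgl 0).1
  simp only [Finset.range_zero, Finset.sum_empty, sub_zero, pow_zero, mul_one] at hLip hSup
  have hBD := series_BD (β := β) hβbdd hβcover (by positivity) hga hgl
    (g' := fun n x => ((-(2*A*ε^2*(1/4)^n) * k) * ((ε/(4*R))⁻¹*2^n)) •
      b' (z0 + ((ε/(4*R))⁻¹*2^n) • (x - v n)))
    (fun n => by
      have := hb.comp (-(2*A*ε^2*(1/4)^n) * k) ((ε/(4*R))⁻¹*2^n) (by positivity) z0 (v n)
      simpa only [hφ, mul_assoc] using this)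
  have hl : 2*(2*A*ε^2/(ε/(4*R))*L) ≤ ε := by
    have : 2*(2*A*ε^2/(ε/(4*R))*L) = ε / M := by
      rw [hA]; field_simp; norm_num
    rw [this]
    exact div_le_self hε.le hM1
  have ha : 2*(2*A*ε^2*M) ≤ ε := by
    have : 2*(2*A*ε^2*M) = ε * (ε / (4 * (L * R))) := by
      rw [hA]; field_simp; norm_num
    rw [this]
    have hLR : 1 ≤ L * R := by nlinarith
    have : ε / (4 * (L * R)) ≤ 1 := by
      rw [div_le_one (by positivity)]; linarith
    nlinarith
  refine ⟨_, _, y, ⟨_, by positivity, hLip⟩, hBD, ?_, fun z => (hSup z).trans ha,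
    fun z => (hBD.norm_le hβcover (by positivity) hLip z).trans hl, fun w => ?_⟩
  · have : 2*R*(ε/(4*R)) = ε/2 := by field_simp; norm_num
    rw [this] at hyd
    linarith
  · by_cases hw : f w = ⊤
    · rw [hw, EReal.top_add_coe]; exact le_top
    · rw [hcoe w hw, hcoe y hyD]
      exact_mod_cast hmin w hw

end helpers

theorem symmetric_deville_godefroy_zizler
    {X : Type*} [NormedAddCommGroup X] [NormedSpace ℝ X] [CompleteSpace X]
    {V : Type*} [NormedAddCommGroup V] [NormedSpace ℝ V] [CompleteSpace V]
    {W : Type*} [NormedAddCommGroup W] [NormedSpace ℝ W] [CompleteSpace W]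
    (ι : X →L[ℝ] V) (κ : V →L[ℝ] W)
    (K : ℝ) (hK : 0 < K) (hιK : ∀ u : X, ‖ι u‖ ≤ K * ‖u‖)
    (S : Set X)
    {P : Type*} [TopologicalSpace P] [PathConnectedSpace P]
    (pol : X → P → X) (sy : X → X)
    (hpolS : ∀ u ∈ S, ∀ H : P, pol u H ∈ S)
    (hsyS : ∀ u : X, sy u ∈ S)
    (hpolCont : ContinuousOn (fun q : X × P => pol q.1 q.2) (S ×ˢ Set.univ))
    (hsypol : ∀ u ∈ S, ∀ H : P,
      pol (sy u) H = sy u ∧ sy (pol u H) = sy u ∧ pol (pol u H) H = pol u H)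
    (happrox : ∃ Hs : ℕ → P, ∀ u ∈ S,
      Filter.Tendsto (fun m => ι (List.foldl pol u ((List.range m).map Hs)))
        Filter.atTop (nhds (ι (sy u))))
    (hpolContr : ∀ u ∈ S, ∀ v ∈ S, ∀ H : P, ‖ι (pol u H) - ι (pol v H)‖ ≤ ‖ι u - ι v‖)
    (Θ : X → X) (CΘ : ℝ) (hCΘ : 0 < CΘ)
    (hΘS : ∀ u : X, Θ u ∈ S) (hΘid : ∀ u ∈ S, Θ u = u)
    (hΘlip : ∀ u v : X, ‖ι (Θ u) - ι (Θ v)‖ ≤ CΘ * ‖ι u - ι v‖)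
    (hpolext : ∀ u : X, ∀ H : P, pol u H = pol (Θ u) H)
    (hsyext : ∀ u : X, sy u = sy (Θ u))
    (T : ℝ → X → X)
    (hTS : ∀ ρ > (0:ℝ), ∀ u ∈ S, T ρ u ∈ S)
    (hTpol : ∀ ρ > (0:ℝ), ∀ u ∈ S, ∃ l : List P, T ρ u = List.foldl pol u l)
    (hTsy : ∀ ρ > (0:ℝ), ∀ u ∈ S, sy (T ρ u) = sy u)
    (hTapprox : ∀ ρ > (0:ℝ), ∀ u ∈ S, ‖ι (T ρ u) - ι (sy u)‖ < ρ)
    (f : X → EReal)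
    (hfproper : ∃ u, f u ≠ ⊤)
    (hfbdd : ∃ c : ℝ, ∀ u, (c : EReal) ≤ f u)
    (hflsc : LowerSemicontinuous f)
    (hfpol : ∀ u ∈ S, ∀ H : P, f (pol u H) ≤ f u)
    (β : Set (Set X))
    (hβbdd : ∀ B ∈ β, Bornology.IsBounded B)
    (hβcover : ∀ x : X, ∃ B ∈ β, x ∈ B)
    (hβdirected : ∀ B₁ ∈ β, ∀ B₂ ∈ β, ∃ B ∈ β, B₁ ∪ B₂ ⊆ B)
    (hbump : ∃ (b : X → ℝ) (b' : X → X →L[ℝ] ℝ),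
      (∃ M : ℝ, ∀ z : X, |b z| ≤ M) ∧
      (∃ L : ℝ, 0 ≤ L ∧ ∀ z₁ z₂ : X, |b z₁ - b z₂| ≤ L * ‖z₁ - z₂‖) ∧
      (∀ z : X, ∀ B ∈ β, ∀ ε > (0:ℝ), ∃ δ > (0:ℝ), ∀ t : ℝ, t ≠ 0 → |t| < δ →
        ∀ w ∈ B, |b (z + t • w) - b z - t * (b' z) w| ≤ ε * |t|) ∧
      (Function.support b).Nonempty ∧ Bornology.IsBounded (Function.support b)) :
    ∃ A : ℝ, 0 < A ∧ ∀ ε : ℝ, 0 < ε → ε < 1 → ∀ u ∈ S,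
      f u < (⨅ w, f w) + ((A * ε ^ 2 : ℝ) : EReal) →
      ∃ (g : X → ℝ) (g' : X → X →L[ℝ] ℝ) (v : X),
        (∃ M : ℝ, ∀ z : X, |g z| ≤ M) ∧
        (∃ L : ℝ, 0 ≤ L ∧ ∀ z₁ z₂ : X, |g z₁ - g z₂| ≤ L * ‖z₁ - z₂‖) ∧
        (∀ z : X, ∀ B ∈ β, ∀ ε' > (0:ℝ), ∃ δ > (0:ℝ), ∀ t : ℝ, t ≠ 0 → |t| < δ →
          ∀ w ∈ B, |g (z + t • w) - g z - t * (g' z) w| ≤ ε' * |t|) ∧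
        ‖ι v - ι (sy v)‖ < (K * (CΘ + 1) + 1) * ε ∧
        ‖v - u‖ ≤ ε + ‖T ε u - u‖ ∧
        (∀ z : X, |g z| ≤ ε) ∧ (∀ z : X, ‖g' z‖ ≤ ε) ∧
        (∀ w : X, f v + ((g v : ℝ) : EReal) ≤ f w + ((g w : ℝ) : EReal)) := by
  obtain ⟨b, b', hbM, hbL, hb, hbn, hbb⟩ := hbump
  obtain ⟨A, hA, H⟩ := dgz (β := β) f hfbdd hflsc hβbdd hβcover b b' hbM hbL hb hbn hbb
  refine ⟨A, hA, fun ε hε hε1 u hu hfu => ?_⟩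
  have hfold : ∀ l : List P, ∀ x ∈ S, f (List.foldl pol x l) ≤ f x := by
    intro l
    induction l with
    | nil => intro x _; exact le_rfl
    | cons a l ih => intro x hx; exact (ih _ (hpolS x hx a)).trans (hfpol x hx a)
  have hcontr : ∀ l : List P, ∀ x ∈ S, ∀ y ∈ S,
      ‖ι (List.foldl pol x l) - ι (List.foldl pol y l)‖ ≤ ‖ι x - ι y‖ := by
    intro l
    induction l with
    | nil => intro x _ y _; exact le_rfl
    | cons a l ih =>
      intro x hx y hy
      exact (ih _ (hpolS x hx a) _ (hpolS y hy a)).trans (hpolContr x hx y hy a)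
  have hsyc : ∀ x ∈ S, ∀ y ∈ S, ‖ι (sy x) - ι (sy y)‖ ≤ ‖ι x - ι y‖ := by
    obtain ⟨Hs, hHs⟩ := happrox
    intro x hx y hy
    exact le_of_tendsto ((hHs x hx).sub (hHs y hy)).norm
      (Filter.Eventually.of_forall fun n => hcontr _ x hx y hy)
  have hfT : f (T ε u) ≤ f u := by
    obtain ⟨l, hl⟩ := hTpol ε hε u hu
    rw [hl]; exact hfold l u hu
  have hTu := hTS ε hε u hu
  obtain ⟨g, g', v, hgL, hgBD, hvd, hgs, hgd, hmin⟩ := H ε hε hε1 (T ε u) (hfT.trans_lt hfu)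
  refine ⟨g, g', v, ⟨ε, hgs⟩, hgL, hgBD, ?_, ?_, hgs, hgd, hmin⟩
  · have h1 : ‖ι v - ι (T ε u)‖ ≤ K * ‖v - T ε u‖ := by
      rw [← map_sub]; exact hιK _
    have h2 := hTapprox ε hε u hu
    have h3 : ‖ι (sy u) - ι (sy v)‖ ≤ CΘ * (K * ‖v - T ε u‖) := by
      rw [← hTsy ε hε u hu, hsyext v]
      refine (hsyc _ hTu _ (hΘS v)).trans ?_
      have := hΘlip (T ε u) v
      rw [hΘid _ hTu] at this
      refine this.trans ?_
      rw [norm_sub_rev]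
      gcongr
    have h4 : ι v - ι (sy v) = (ι v - ι (T ε u)) + (ι (T ε u) - ι (sy u)) +
        (ι (sy u) - ι (sy v)) := by abel
    rw [h4]
    have h5 := norm_add₃_le (a := ι v - ι (T ε u)) (b := ι (T ε u) - ι (sy u))
      (c := ι (sy u) - ι (sy v))
    have h6 : K * ‖v - T ε u‖ ≤ K * ε := by gcongr
    have h7 : CΘ * (K * ‖v - T ε u‖) ≤ CΘ * (K * ε) := by gcongr
    linarith
  · have := norm_add_le (v - T ε u) (T ε u - u)
    rw [sub_add_sub_cancel] at this
    linarith
end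

section
/- Existence of symmetric quasi-convex Palais–Smale sequences at the infimum level. In the abstract symmetrization framework, let X be a real Hilbert space and f : X → ℝ a lower semicontinuous functional bounded from below such that: (i) f(u^H) ≤ f(u) for all u ∈ S and all H ∈ ℋ*; (ii) there exists a map Ξ : X → S with f(Ξ(u)) ≤ f(u) for all u ∈ X, mapping bounded sequences of X to bounded sequences of S; (iii) ‖u^H‖ ≤ ‖u‖ for all u ∈ S and H ∈ ℋ*; (iv) f admits a bounded minimizing sequence. Then f admits a sequence (v_h) ⊂ X with f(v_h) → inf_X f, |df|(v_h) → 0, ‖v_h − v_h*‖_V → 0, and liminf_h Q_{v_h}(w) ≥ 0 for every w ∈ X (i.e., an (SQPS)_{inf f}-sequence). -/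
open Filter Topology Metric Set

noncomputable def weakSlope {X : Type*} [NormedAddCommGroup X] [NormedSpace ℝ X]
    (f : X → ℝ) (u : X) : EReal :=
  sSup {σ : EReal | ∃ s : ℝ, 0 ≤ s ∧ σ = (s : EReal) ∧ ∃ δ : ℝ, 0 < δ ∧
    ∃ D : (X × ℝ) × ℝ → X,
      ContinuousOn D ((Metric.ball ((u, f u)) δ ∩
          {p : X × ℝ | f p.1 ≤ p.2}) ×ˢ Set.Icc 0 δ) ∧
      ∀ p ∈ Metric.ball ((u, f u)) δ ∩ {p : X × ℝ | f p.1 ≤ p.2},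
        ∀ t ∈ Set.Icc (0:ℝ) δ,
          ‖D (p, t) - p.1‖ ≤ t ∧ f (D (p, t)) ≤ f p.1 - s * t}

noncomputable def Qform {X : Type*} [NormedAddCommGroup X] [NormedSpace ℝ X]
    (f : X → ℝ) (u w : X) : EReal :=
  Filter.limsup
    (fun q : (X × X) × ℝ =>
      (((f (q.1.1 + q.2 • q.1.2) + f (q.1.1 - q.2 • q.1.2) - 2 * f q.1.1) / q.2 ^ 2 : ℝ) : EReal))
    (((nhds u) ×ˢ (nhds w)) ×ˢ (nhdsWithin 0 {t : ℝ | t ≠ 0}))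

theorem bp_principle {X : Type*} [NormedAddCommGroup X] [InnerProductSpace ℝ X] [CompleteSpace X]
    (f : X → ℝ) (hb : BddBelow (Set.range f)) (hl : LowerSemicontinuous f)
    (η : ℝ) (hη : 0 < η) (z : X) (hz : ∀ x, f z ≤ f x + η ^ 3) :
    ∃ v, f v ≤ f z ∧ ‖v - z‖ ≤ η ∧
      (∀ d, f v ≤ f (v + d) + 2 * η * (‖d‖ ^ 2 + 4 * η * ‖d‖)) ∧
      (∀ d, 2 * f v ≤ f (v + d) + f (v - d) + 4 * η * ‖d‖ ^ 2) := by
  have hstep : ∀ (n : ℕ) (F : X → ℝ) (v : X), BddBelow (Set.range F) →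
      ∃ v', F v' ≤ F v ∧ ∀ x, F v' ≤ F x + η ^ 3 / 4 ^ (n + 1) := by
    intro n F v hF
    have hpos : 0 < η ^ 3 / 4 ^ (n + 1) := by positivity
    obtain ⟨x, hx⟩ := exists_lt_of_ciInf_lt (lt_add_of_pos_right (⨅ x, F x) hpos)
    have hx' : ∀ y, F x ≤ F y + η ^ 3 / 4 ^ (n + 1) := fun y => by
      have := ciInf_le hF y
      linarith
    by_cases h : F v ≤ F x
    · exact ⟨v, le_refl _, fun y => h.trans (hx' y)⟩
    · exact ⟨x, (not_le.1 h).le, hx'⟩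
  choose! step hs1 hs2 using hstep
  let μ : ℕ → ℝ := fun n => η / 2 ^ n
  have hμ : ∀ n, 0 < μ n := fun n => by positivity
  let s : ℕ → (X → ℝ) × X := fun n => Nat.rec (f, z)
    (fun n p => (fun x => p.1 x + μ n * ‖x - p.2‖ ^ 2,
      step n (fun x => p.1 x + μ n * ‖x - p.2‖ ^ 2) p.2)) n
  let F : ℕ → X → ℝ := fun n => (s n).1
  let v : ℕ → X := fun n => (s n).2
  have hF0 : F 0 = f := rfl
  have hv0 : v 0 = z := rfl
  have hFs : ∀ n x, F (n + 1) x = F n x + μ n * ‖x - v n‖ ^ 2 := fun n x => rfl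
  have hvs : ∀ n, v (n + 1) = step n (F (n + 1)) (v n) := fun n => rfl
  have hmono1 : ∀ n x, F n x ≤ F (n + 1) x := fun n x => by
    rw [hFs]
    have := hμ n
    have : 0 ≤ μ n * ‖x - v n‖ ^ 2 := by positivity
    linarith
  have hbd : ∀ n, BddBelow (Set.range (F n)) := by
    intro n
    induction n with
    | zero => exact hb
    | succ n ih =>
      obtain ⟨c, hc⟩ := ih
      refine ⟨c, ?_⟩
      rintro _ ⟨x, rfl⟩
      exact (hc ⟨x, rfl⟩).trans (hmono1 n x)
  have hlsc : ∀ n, LowerSemicontinuous (F n) := by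
    intro n
    induction n with
    | zero => exact hl
    | succ n ih =>
      have hc : Continuous (fun x => μ n * ‖x - v n‖ ^ 2) := by fun_prop
      exact ih.add hc.lowerSemicontinuous
  have hself : ∀ n, F (n + 1) (v n) = F n (v n) := fun n => by simp [hFs]
  have hdec : ∀ n, F (n + 1) (v (n + 1)) ≤ F n (v n) := fun n => by
    rw [← hself, hvs]
    exact hs1 n (F (n + 1)) (v n) (hbd (n + 1))
  have hmin : ∀ n x, F n (v n) ≤ F n x + η ^ 3 / 4 ^ n := by
    intro n x
    cases n with
    | zero => rw [hF0, hv0, pow_zero, div_one]; exact hz x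
    | succ n => 
      rw [hvs]
      exact hs2 n (F (n + 1)) (v n) (hbd (n + 1)) x
  have hdist : ∀ n x, F (n + 1) x ≤ F n (v n) → ‖x - v n‖ ^ 2 ≤ η ^ 2 / 2 ^ n := by
    intro n x hx
    have h1 := hmin n x
    rw [hFs] at hx
    have h2 : μ n * ‖x - v n‖ ^ 2 ≤ η ^ 3 / 4 ^ n := by linarith
    have h3 : η ^ 3 / 4 ^ n = μ n * (η ^ 2 / 2 ^ n) := by
      have : (4 : ℝ) ^ n = 2 ^ n * 2 ^ n := by rw [← mul_pow]; norm_num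
      simp only [μ]
      rw [this]
      field_simp
    rw [h3] at h2
    exact le_of_mul_le_mul_left h2 (hμ n)
  have hnest : ∀ n k x, F (n + k + 1) x ≤ F (n + k) (v (n + k)) → F (n + 1) x ≤ F n (v n) := by
    intro n k x
    induction k with
    | zero => exact id
    | succ k ih =>
      intro h
      exact ih ((hmono1 (n + k + 1) x).trans (h.trans (hdec (n + k))))
  have hmem : ∀ n m, n ≤ m → F (n + 1) (v m) ≤ F n (v n) := by
    intro n m h
    obtain ⟨k, rfl⟩ := Nat.exists_eq_add_of_le h
    exact hnest n k _ (hself _).le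
  have hr : Tendsto (fun n : ℕ => η ^ 2 / 2 ^ n) atTop (𝓝 0) := by
    have := (tendsto_pow_atTop_nhds_zero_of_lt_one (r := (1/2 : ℝ)) (by norm_num)
      (by norm_num)).const_mul (η ^ 2)
    simpa [div_eq_mul_inv] using this
  have hcau : CauchySeq v := by
    rw [Metric.cauchySeq_iff']
    intro e he
    obtain ⟨N, hN⟩ := (hr.eventually (gt_mem_nhds (show (0:ℝ) < e ^ 2 by positivity))).exists
    refine ⟨N, fun n hn => ?_⟩
    have := (hdist N (v n) (hmem N n hn)).trans_lt hN
    rw [dist_eq_norm]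
    exact lt_of_pow_lt_pow_left₀ 2 he.le this
  obtain ⟨w, hw⟩ := cauchySeq_tendsto_of_complete hcau
  have hwm : ∀ n, F (n + 1) w ≤ F n (v n) := by
    intro n
    exact ((hlsc (n + 1)).isClosed_preimage (F n (v n))).mem_of_tendsto hw
      (eventually_atTop.2 ⟨n, fun m hm => hmem n m hm⟩)
  have hz0 : ∀ x, F 1 x ≤ F 0 (v 0) → ‖x - z‖ ≤ η := by
    intro x hx
    have := hdist 0 x hx
    rw [hv0] at this
    simp only [pow_zero, div_one] at this
    exact le_of_sq_le_sq this hη.le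
  have hwz := hz0 w (hwm 0)
  have hvz : ∀ n, ‖v n - z‖ ≤ η := fun n => hz0 _ (hmem 0 n (Nat.zero_le _))
  have hwv : ∀ n, ‖w - v n‖ ≤ 2 * η := fun n => by
    have := norm_sub_le_norm_sub_add_norm_sub w z (v n)
    have h2 := hvz n
    rw [norm_sub_rev] at h2
    linarith
  have hsum : ∀ n x, F n x = f x + ∑ k ∈ Finset.range n, μ k * ‖x - v k‖ ^ 2 := by
    intro n x
    induction n with
    | zero => simp [hF0]
    | succ n ih => rw [hFs, ih, Finset.sum_range_succ]; ring
  have hμs : ∀ n, ∑ k ∈ Finset.range n, μ k ≤ 2 * η := by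
    intro n
    have : ∑ k ∈ Finset.range n, μ k = 2 * η - 2 * η / 2 ^ n := by
      induction n with
      | zero => simp
      | succ n ih =>
        rw [Finset.sum_range_succ, ih]
        simp only [μ]
        field_simp
        ring
    rw [this]
    have : 0 < 2 * η / 2 ^ n := by positivity
    linarith
  have hkey : ∀ n x, F n w ≤ F n x + η ^ 3 / 4 ^ n := fun n x =>
    (hmono1 n w).trans ((hwm n).trans (hmin n x))
  have hlim : Tendsto (fun n : ℕ => η ^ 3 / 4 ^ n) atTop (𝓝 0) := by
    have := (tendsto_pow_atTop_nhds_zero_of_lt_one (r := (1/4 : ℝ)) (by norm_num)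
      (by norm_num)).const_mul (η ^ 3)
    simpa [div_eq_mul_inv] using this
  refine ⟨w, ?_, hwz, ?_, ?_⟩
  · exact (hmono1 0 w).trans (hwm 0)
  · intro d
    have hn : ∀ n : ℕ, f w ≤ f (w + d) + 2 * η * (‖d‖ ^ 2 + 4 * η * ‖d‖) + η ^ 3 / 4 ^ n := by
      intro n
      have h := hkey n (w + d)
      rw [hsum, hsum] at h
      have h2 : ∑ k ∈ Finset.range n, μ k * ‖w + d - v k‖ ^ 2 ≤
          ∑ k ∈ Finset.range n, μ k * ‖w - v k‖ ^ 2
          + (∑ k ∈ Finset.range n, μ k) * (‖d‖ ^ 2 + 4 * η * ‖d‖) := by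
        rw [Finset.sum_mul, ← Finset.sum_add_distrib]
        refine Finset.sum_le_sum fun k _ => ?_
        rw [← mul_add]
        refine mul_le_mul_of_nonneg_left ?_ (hμ k).le
        have e : w + d - v k = (w - v k) + d := by abel
        have t := norm_add_le (w - v k) d
        rw [e]
        nlinarith [hwv k, norm_nonneg d, norm_nonneg (w - v k), norm_nonneg (w - v k + d)]
      have h3 := mul_le_mul_of_nonneg_right (hμs n)
        (show 0 ≤ ‖d‖ ^ 2 + 4 * η * ‖d‖ by positivity)
      linarith
    have := ge_of_tendsto' (hlim.const_add _) hn
    simpa using this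
  · intro d
    have hn : ∀ n : ℕ, 2 * f w ≤ f (w + d) + f (w - d) + 4 * η * ‖d‖ ^ 2
        + 2 * (η ^ 3 / 4 ^ n) := by
      intro n
      have h := hkey n (w + d)
      have h' := hkey n (w - d)
      rw [hsum, hsum] at h h'
      have h2 : ∑ k ∈ Finset.range n, μ k * ‖w + d - v k‖ ^ 2
          + ∑ k ∈ Finset.range n, μ k * ‖w - d - v k‖ ^ 2 =
          2 * ∑ k ∈ Finset.range n, μ k * ‖w - v k‖ ^ 2
          + (∑ k ∈ Finset.range n, μ k) * (2 * ‖d‖ ^ 2) := by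
        rw [Finset.sum_mul, Finset.mul_sum, ← Finset.sum_add_distrib, ← Finset.sum_add_distrib]
        refine Finset.sum_congr rfl fun k _ => ?_
        have e : w + d - v k = (w - v k) + d := by abel
        have e' : w - d - v k = (w - v k) - d := by abel
        have t := parallelogram_law_with_norm ℝ (w - v k) d
        rw [e, e']
        linear_combination μ k * t
      have h3 := mul_le_mul_of_nonneg_right (hμs n)
        (show 0 ≤ 2 * ‖d‖ ^ 2 by positivity)
      linarith
    have := ge_of_tendsto' ((hlim.const_mul 2).const_add _) hn
    simpa using this

theorem weakSlope_bound {X : Type*} [NormedAddCommGroup X] [NormedSpace ℝ X]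
    (f : X → ℝ) (v : X) (η : ℝ) (hη : 0 < η)
    (h : ∀ d, f v ≤ f (v + d) + 2 * η * (‖d‖ ^ 2 + 4 * η * ‖d‖)) :
    weakSlope f v ≤ ((8 * η ^ 2 : ℝ) : EReal) := by
  refine sSup_le ?_
  rintro _ ⟨s, hs, rfl, δ, hδ, D, -, hD⟩
  rw [EReal.coe_le_coe_iff]
  have key : ∀ t ∈ Set.Ioc 0 δ, s ≤ 2 * η * (t + 4 * η) := by
    intro t ht
    obtain ⟨h1, h2⟩ := hD (v, f v) ⟨Metric.mem_ball_self hδ, le_refl (f v)⟩ t ⟨ht.1.le, ht.2⟩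
    have h3 := h (D ((v, f v), t) - v)
    rw [add_sub_cancel] at h3
    simp only at h1 h2
    have h5 : ‖D ((v, f v), t) - v‖ ^ 2 + 4 * η * ‖D ((v, f v), t) - v‖ ≤ t ^ 2 + 4 * η * t := by
      gcongr
    have h6 := mul_le_mul_of_nonneg_left h5 (show 0 ≤ 2 * η by positivity)
    have h4 : s * t ≤ (2 * η * (t + 4 * η)) * t := by nlinarith
    exact le_of_mul_le_mul_right h4 ht.1
  have hev : ∀ᶠ t in 𝓝[>] (0 : ℝ), s ≤ 2 * η * (t + 4 * η) := by
    filter_upwards [Ioc_mem_nhdsGT hδ] with t ht using key t ht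
  have hc : Tendsto (fun t : ℝ => 2 * η * (t + 4 * η)) (𝓝[>] 0) (𝓝 (2 * η * (0 + 4 * η))) :=
    (Continuous.tendsto (by fun_prop) 0).mono_left nhdsWithin_le_nhds
  have := ge_of_tendsto hc hev
  linarith

theorem weakSlope_nonneg {X : Type*} [NormedAddCommGroup X] [NormedSpace ℝ X]
    (f : X → ℝ) (v : X) : 0 ≤ weakSlope f v := by
  refine le_sSup ⟨0, le_refl _, rfl, 1, one_pos, fun q => q.1.1, by fun_prop, ?_⟩
  intro p _ t ht
  simpa using ht.1

theorem Qform_bound {X : Type*} [NormedAddCommGroup X] [NormedSpace ℝ X]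
    (f : X → ℝ) (v w : X) (η : ℝ)
    (h : ∀ d, 2 * f v ≤ f (v + d) + f (v - d) + 4 * η * ‖d‖ ^ 2) :
    ((-(4 * η * ‖w‖ ^ 2) : ℝ) : EReal) ≤ Qform f v w := by
  have ht : Tendsto (fun t : ℝ => ((v, w), t)) (𝓝[{t : ℝ | t ≠ 0}] 0)
      (((𝓝 v) ×ˢ (𝓝 w)) ×ˢ (𝓝[{t : ℝ | t ≠ 0}] 0)) := by
    refine Tendsto.prodMk (Tendsto.prodMk ?_ ?_) tendsto_id
    · exact tendsto_const_nhds
    · exact tendsto_const_nhds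
  have : NeBot (𝓝[{t : ℝ | t ≠ 0}] (0 : ℝ)) := inferInstanceAs (NeBot (𝓝[≠] (0 : ℝ)))
  refine le_limsup_of_frequently_le (ht.frequently (Eventually.frequently ?_))
  filter_upwards [self_mem_nhdsWithin] with t (ht : t ≠ 0)
  rw [EReal.coe_le_coe_iff, le_div_iff₀ (by positivity)]
  have := h (t • w)
  rw [norm_smul, mul_pow, Real.norm_eq_abs, sq_abs] at this
  linarith

theorem exists_SQPS_sequence
    {X : Type*} [NormedAddCommGroup X] [InnerProductSpace ℝ X] [CompleteSpace X]
    {V : Type*} [NormedAddCommGroup V] [NormedSpace ℝ V] [CompleteSpace V]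
    {W : Type*} [NormedAddCommGroup W] [NormedSpace ℝ W] [CompleteSpace W]
    (ι : X →L[ℝ] V) (κ : V →L[ℝ] W)
    (K : ℝ) (hK : 0 < K) (hιK : ∀ u : X, ‖ι u‖ ≤ K * ‖u‖)
    (S : Set X)
    {P : Type*} [TopologicalSpace P] [PathConnectedSpace P]
    (pol : X → P → X) (sy : X → X)
    (hpolS : ∀ u ∈ S, ∀ H : P, pol u H ∈ S)
    (hsyS : ∀ u : X, sy u ∈ S)
    (hpolCont : ContinuousOn (fun q : X × P => pol q.1 q.2) (S ×ˢ Set.univ))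
    (hsypol : ∀ u ∈ S, ∀ H : P,
      pol (sy u) H = sy u ∧ sy (pol u H) = sy u ∧ pol (pol u H) H = pol u H)
    (happrox : ∃ Hs : ℕ → P, ∀ u ∈ S,
      Filter.Tendsto (fun m => ι (List.foldl pol u ((List.range m).map Hs)))
        Filter.atTop (nhds (ι (sy u))))
    (hpolContr : ∀ u ∈ S, ∀ v ∈ S, ∀ H : P, ‖ι (pol u H) - ι (pol v H)‖ ≤ ‖ι u - ι v‖)
    (Θ : X → X) (CΘ : ℝ) (hCΘ : 0 < CΘ)
    (hΘS : ∀ u : X, Θ u ∈ S) (hΘid : ∀ u ∈ S, Θ u = u)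
    (hΘlip : ∀ u v : X, ‖ι (Θ u) - ι (Θ v)‖ ≤ CΘ * ‖ι u - ι v‖)
    (hpolext : ∀ u : X, ∀ H : P, pol u H = pol (Θ u) H)
    (hsyext : ∀ u : X, sy u = sy (Θ u))
    (f : X → ℝ)
    (hfbdd : BddBelow (Set.range f))
    (hflsc : LowerSemicontinuous f)
    (hfpol : ∀ u ∈ S, ∀ H : P, f (pol u H) ≤ f u)
    (Ξ : X → X) (hΞS : ∀ u : X, Ξ u ∈ S) (hΞf : ∀ u : X, f (Ξ u) ≤ f u)
    (hΞbdd : ∀ us : ℕ → X, (∃ M : ℝ, ∀ n, ‖us n‖ ≤ M) → ∃ M' : ℝ, ∀ n, ‖Ξ (us n)‖ ≤ M')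
    (hpolnorm : ∀ u ∈ S, ∀ H : P, ‖pol u H‖ ≤ ‖u‖)
    (hmin : ∃ us : ℕ → X, (∃ M : ℝ, ∀ n, ‖us n‖ ≤ M) ∧
      Filter.Tendsto (fun n => f (us n)) Filter.atTop (nhds (⨅ w, f w)))
 :
    ∃ vs : ℕ → X,
      Filter.Tendsto (fun h => f (vs h)) Filter.atTop (nhds (⨅ w, f w)) ∧
      Filter.Tendsto (fun h => weakSlope f (vs h)) Filter.atTop (nhds (0 : EReal)) ∧
      Filter.Tendsto (fun h => ‖ι (vs h) - ι (sy (vs h))‖) Filter.atTop (nhds 0) ∧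
      ∀ w : X, (0 : EReal) ≤ Filter.liminf (fun h => Qform f (vs h) w) Filter.atTop := by
  classical
  obtain ⟨Hs, hHs⟩ := happrox
  have hfold : ∀ (l : List P) (u : X), u ∈ S →
      List.foldl pol u l ∈ S ∧ sy (List.foldl pol u l) = sy u ∧ f (List.foldl pol u l) ≤ f u := by
    intro l
    induction l with
    | nil => exact fun u hu => ⟨hu, rfl, le_refl _⟩
    | cons H l ih =>
      intro u hu
      obtain ⟨h1, h2, h3⟩ := ih (pol u H) (hpolS u hu H)
      exact ⟨h1, h2.trans (hsypol u hu H).2.1, h3.trans (hfpol u hu H)⟩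
  have hfoldc : ∀ (l : List P) (u v : X), u ∈ S → v ∈ S →
      ‖ι (List.foldl pol u l) - ι (List.foldl pol v l)‖ ≤ ‖ι u - ι v‖ := by
    intro l
    induction l with
    | nil => exact fun u v _ _ => le_refl _
    | cons H l ih =>
      intro u v hu hv
      exact (ih _ _ (hpolS u hu H) (hpolS v hv H)).trans (hpolContr u hu v hv H)
  have hsyc : ∀ u ∈ S, ∀ v ∈ S, ‖ι (sy u) - ι (sy v)‖ ≤ ‖ι u - ι v‖ := fun u hu v hv =>
    le_of_tendsto' ((hHs u hu).sub (hHs v hv)).norm (fun m => hfoldc _ u v hu hv)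
  have main : ∀ η : ℝ, 0 < η → ∃ v : X, f v ≤ (⨅ w, f w) + η ^ 3 ∧
      ‖ι v - ι (sy v)‖ ≤ (K + 1 + CΘ * K) * η ∧
      (∀ d, f v ≤ f (v + d) + 2 * η * (‖d‖ ^ 2 + 4 * η * ‖d‖)) ∧
      (∀ d, 2 * f v ≤ f (v + d) + f (v - d) + 4 * η * ‖d‖ ^ 2) := by
    intro η hη
    obtain ⟨u, hu⟩ := exists_lt_of_ciInf_lt
      (lt_add_of_pos_right (⨅ x, f x) (show 0 < η ^ 3 by positivity))
    have hm := (hHs (Ξ u) (hΞS u)).eventually (Metric.ball_mem_nhds _ hη)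
    obtain ⟨m, hm⟩ := hm.exists
    obtain ⟨hz1, hz2, hz3⟩ := hfold ((List.range m).map Hs) (Ξ u) (hΞS u)
    set z := List.foldl pol (Ξ u) ((List.range m).map Hs) with hzdef
    have hm' : ‖ι z - ι (sy z)‖ < η := by
      rw [hz2, ← dist_eq_norm]
      exact hm
    have hfz : f z ≤ (⨅ w, f w) + η ^ 3 := by
      have := hΞf u
      linarith
    obtain ⟨v, hv1, hv2, hv3, hv4⟩ := bp_principle f hfbdd hflsc η hη z (fun x => by
      have := ciInf_le hfbdd x
      linarith)
    refine ⟨v, hv1.trans hfz, ?_, hv3, hv4⟩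
    have h1 : ‖ι v - ι z‖ ≤ K * η := by
      rw [← map_sub]
      exact (hιK _).trans (mul_le_mul_of_nonneg_left hv2 hK.le)
    have h2 : ‖ι (sy z) - ι (sy v)‖ ≤ CΘ * (K * η) := by
      rw [hsyext v]
      have a := hsyc z hz1 (Θ v) (hΘS v)
      have b := hΘlip z v
      rw [hΘid z hz1, norm_sub_rev (ι z) (ι v)] at b
      exact a.trans (b.trans (mul_le_mul_of_nonneg_left h1 hCΘ.le))
    have h3 := norm_sub_le_norm_sub_add_norm_sub (ι v) (ι z) (ι (sy v))
    have h4 := norm_sub_le_norm_sub_add_norm_sub (ι z) (ι (sy z)) (ι (sy v))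
    linarith
  choose! g hg1 hg2 hg3 hg4 using main
  let η : ℕ → ℝ := fun n => 1 / ((n : ℝ) + 1)
  have hη : ∀ n, 0 < η n := fun n => Nat.one_div_pos_of_nat
  have hη0 : Tendsto η atTop (𝓝 0) := tendsto_one_div_add_atTop_nhds_zero_nat
  refine ⟨fun n => g (η n), ?_, ?_, ?_, ?_⟩
  · have hc : Tendsto (fun n => (⨅ w, f w) + η n ^ 3) atTop (𝓝 (⨅ w, f w)) := by
      simpa using (hη0.pow 3).const_add (⨅ w, f w)
    exact tendsto_of_tendsto_of_tendsto_of_le_of_le tendsto_const_nhds hc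
      (fun n => ciInf_le hfbdd _) (fun n => hg1 _ (hη n))
  · have hc : Tendsto (fun n => ((8 * η n ^ 2 : ℝ) : EReal)) atTop (𝓝 ((0 : ℝ) : EReal)) := by
      refine EReal.tendsto_coe.2 ?_
      simpa using (hη0.pow 2).const_mul 8
    exact tendsto_of_tendsto_of_tendsto_of_le_of_le tendsto_const_nhds hc
      (fun n => weakSlope_nonneg f _) (fun n => weakSlope_bound f _ _ (hη n) (hg3 _ (hη n)))
  · have hc : Tendsto (fun n => (K + 1 + CΘ * K) * η n) atTop (𝓝 0) := by
      simpa using hη0.const_mul (K + 1 + CΘ * K)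
    exact squeeze_zero (fun n => norm_nonneg _) (fun n => hg2 _ (hη n)) hc
  · intro w
    have hc : Tendsto (fun n => ((-(4 * η n * ‖w‖ ^ 2) : ℝ) : EReal)) atTop
        (𝓝 ((0 : ℝ) : EReal)) := by
      refine EReal.tendsto_coe.2 ?_
      simpa using ((hη0.const_mul 4).mul_const (‖w‖ ^ 2)).neg
    have h0 := hc.liminf_eq
    rw [EReal.coe_zero] at h0
    rw [← h0]
    exact liminf_le_liminf (Eventually.of_forall fun n => Qform_bound f _ w _ (hg4 _ (hη n)))
end
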